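/- Let P, Q ∈ ℂ[X₁,…,Xₙ] be such that Z_P ⊆ Z_Q. If Q is of type A, then P is of type A; that is, if every positive definite linear functional on ℂ[X₁,…,Xₙ] vanishing on the ideal (Q) is a moment functional, then every positive definite linear functional vanishing on the ideal (P) is a moment functional. -/

import Mathlib

open MeasureTheory
open scoped ComplexOrder

noncomputable def evalC {n : ℕ} (P : MvPolynomial (Fin n) ℂ) (x : Fin n → ℝ) : ℂ :=
  MvPolynomial.aeval (fun i => (x i : ℂ)) P

noncomputable def starC {n : ℕ} (P : MvPolynomial (Fin n) ℂ) : MvPolynomial (Fin n) ℂ :=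
  MvPolynomial.map (starRingEnd ℂ) P

def IsPosDefC {n : ℕ} (Λ : MvPolynomial (Fin n) ℂ →ₗ[ℂ] ℂ) : Prop :=
  ∀ P : MvPolynomial (Fin n) ℂ, 0 ≤ Λ (starC P * P)

def IsMomentC {n : ℕ} (Λ : MvPolynomial (Fin n) ℂ →ₗ[ℂ] ℂ) : Prop :=
  ∃ μ : Measure (Fin n → ℝ),
    (∀ Q : MvPolynomial (Fin n) ℂ, Integrable (fun x => evalC Q x) μ) ∧
    (∀ Q : MvPolynomial (Fin n) ℂ, Λ Q = ∫ x, evalC Q x ∂μ)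

noncomputable def vanishingIdealC {n : ℕ} (Z : Set (Fin n → ℝ)) :
    Ideal (MvPolynomial (Fin n) ℂ) where
  carrier := {P | ∀ x ∈ Z, evalC P x = 0}
  add_mem' := by
    intro a b ha hb x hx
    simp only [Set.mem_setOf_eq, evalC, map_add] at *
    rw [ha x hx, hb x hx, add_zero]
  zero_mem' := by
    intro x hx
    simp [evalC]
  smul_mem' := by
    intro c a ha x hx
    simp only [Set.mem_setOf_eq, evalC, smul_eq_mul, map_mul] at *
    rw [ha x hx, mul_zero]

def zeroSetC {n : ℕ} (I : Ideal (MvPolynomial (Fin n) ℂ)) : Set (Fin n → ℝ) :=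
  {x | ∀ P ∈ I, evalC P x = 0}

def zSetC {n : ℕ} (P : MvPolynomial (Fin n) ℂ) : Set (Fin n → ℝ) :=
  {x | evalC P x = 0}

def VanishesOnC {n : ℕ} (Λ : MvPolynomial (Fin n) ℂ →ₗ[ℂ] ℂ)
    (I : Ideal (MvPolynomial (Fin n) ℂ)) : Prop :=
  ∀ P ∈ I, Λ P = 0

def nSetC {n : ℕ} (Λ : MvPolynomial (Fin n) ℂ →ₗ[ℂ] ℂ) : Set (MvPolynomial (Fin n) ℂ) :=
  {P | Λ (starC P * P) = 0}

def IsTypeAC {n : ℕ} (P : MvPolynomial (Fin n) ℂ) : Prop :=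
  ∀ Λ : MvPolynomial (Fin n) ℂ →ₗ[ℂ] ℂ,
    IsPosDefC Λ → VanishesOnC Λ (Ideal.span {P}) → IsMomentC Λ

open Polynomial

/-- The intermediate value property for polynomials over an ordered field. -/
def PolynomialIVT (R : Type*) [Field R] [LinearOrder R] : Prop :=
  ∀ (f : R[X]) (a b : R), a < b → f.eval a * f.eval b < 0 → ∃ c ∈ Set.Ioo a b, f.eval c = 0

theorem polynomialIVT_real : PolynomialIVT ℝ := by
  intro f a b hab h
  rcases mul_neg_iff.1 h with h | h
  · exact intermediate_value_Ioo' hab.le f.continuousOn ⟨h.2, h.1⟩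
  · exact intermediate_value_Ioo hab.le f.continuousOn ⟨h.1, h.2⟩

section OrderedField

variable {R : Type*} [Field R] [LinearOrder R] [IsStrictOrderedRing R]

theorem PolynomialIVT.sign_eq (hR : PolynomialIVT R) {f : R[X]} {x y : R} (hxy : x ≤ y)
    (h : ∀ z ∈ Set.Icc x y, f.eval z ≠ 0) :
    SignType.sign (f.eval x) = SignType.sign (f.eval y) := by
  have hx := h x ⟨le_rfl, hxy⟩
  have hy := h y ⟨hxy, le_rfl⟩
  rcases hxy.eq_or_lt with rfl | hlt
  · rfl
  have hprod : 0 < f.eval x * f.eval y := by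
    by_contra hcon
    obtain ⟨c, hc, hc0⟩ := hR f x y hlt
      (lt_of_le_of_ne (not_lt.1 hcon) (mul_ne_zero hx hy))
    exact h c ⟨hc.1.le, hc.2.le⟩ hc0
  rcases mul_pos_iff.1 hprod with h | h
  · rw [sign_pos h.1, sign_pos h.2]
  · rw [sign_neg h.1, sign_neg h.2]

theorem exists_right_no_root {f : R[X]} (hf : f ≠ 0) {y b : R} (hyb : y < b) :
    ∃ y' ∈ Set.Ioo y b, ∀ z ∈ Set.Ioc y y', f.eval z ≠ 0 := by
  classical
  obtain ⟨m, hm, hmin⟩ := (insert b (f.roots.toFinset.filter (y < ·))).exists_min_image id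
    ⟨b, by simp⟩
  have hym : y < m := by
    simp only [Finset.mem_insert, Finset.mem_filter] at hm
    rcases hm with rfl | hm
    · exact hyb
    · exact hm.2
  have hmb : m ≤ b := hmin b (by simp)
  obtain ⟨y', hy', hy'm⟩ := exists_between hym
  refine ⟨y', ⟨hy', hy'm.trans_le hmb⟩, fun z hz h0 => ?_⟩
  have := hmin z (by simp [hf, h0, hz.1])
  exact absurd (hz.2.trans_lt hy'm) (not_lt.2 this)

theorem exists_left_no_root {f : R[X]} (hf : f ≠ 0) {y b : R} (hyb : b < y) :
    ∃ y' ∈ Set.Ioo b y, ∀ z ∈ Set.Ico y' y, f.eval z ≠ 0 := by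
  classical
  obtain ⟨m, hm, hmin⟩ := (insert b (f.roots.toFinset.filter (· < y))).exists_max_image id
    ⟨b, by simp⟩
  have hym : m < y := by
    simp only [Finset.mem_insert, Finset.mem_filter] at hm
    rcases hm with rfl | hm
    · exact hyb
    · exact hm.2
  have hmb : b ≤ m := hmin b (by simp)
  obtain ⟨y', hy'm, hy'⟩ := exists_between hym
  refine ⟨y', ⟨hmb.trans_lt hy'm, hy'⟩, fun z hz h0 => ?_⟩
  have := hmin z (by simp [hf, h0, hz.2])
  exact absurd (hy'm.trans_le hz.1) (not_lt.2 this)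

theorem PolynomialIVT.exists_sign_right (hR : PolynomialIVT R) {f : R[X]} {y b : R} (hyb : y < b)
    (hf : f.eval y ≠ 0) :
    ∃ y' ∈ Set.Ioo y b, SignType.sign (f.eval y') = SignType.sign (f.eval y) := by
  obtain ⟨y', hy', h⟩ := exists_right_no_root (f := f) (by rintro rfl; simp at hf) hyb
  refine ⟨y', hy', (hR.sign_eq hy'.1.le fun z hz => ?_).symm⟩
  rcases hz.1.eq_or_lt with rfl | hlt
  · exact hf
  · exact h z ⟨hlt, hz.2⟩

theorem PolynomialIVT.exists_sign_left (hR : PolynomialIVT R) {f : R[X]} {y b : R} (hyb : b < y)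
    (hf : f.eval y ≠ 0) :
    ∃ y' ∈ Set.Ioo b y, SignType.sign (f.eval y') = SignType.sign (f.eval y) := by
  obtain ⟨y', hy', h⟩ := exists_left_no_root (f := f) (by rintro rfl; simp at hf) hyb
  refine ⟨y', hy', hR.sign_eq hy'.2.le fun z hz => ?_⟩
  rcases hz.2.eq_or_lt with rfl | hlt
  · exact hf
  · exact h z ⟨hz.1, hlt⟩

theorem PolynomialIVT.rolle (hR : PolynomialIVT R) {f : R[X]} {a b : R} (hab : a < b)
    (ha : f.eval a = 0) (hb : f.eval b = 0) : ∃ c ∈ Set.Ioo a b, (derivative f).eval c = 0 := by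
  classical
  rcases eq_or_ne f 0 with rfl | hf
  · obtain ⟨c, hc⟩ := exists_between hab
    exact ⟨c, hc, by simp⟩
  obtain ⟨b', hb'm, hmin⟩ := (f.roots.toFinset.filter (a < ·)).exists_min_image id
    ⟨b, by simp [hf, hb, hab]⟩
  simp only [Finset.mem_filter, Multiset.mem_toFinset, mem_roots hf, IsRoot.def] at hb'm
  have hb'b : b' ≤ b := hmin b (by simp [hf, hb, hab])
  have hab' := hb'm.2
  suffices ∃ c ∈ Set.Ioo a b', (derivative f).eval c = 0 by
    obtain ⟨c, hc, h0⟩ := this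
    exact ⟨c, ⟨hc.1, hc.2.trans_le hb'b⟩, h0⟩
  obtain ⟨g, hg, hga⟩ := exists_eq_pow_rootMultiplicity_mul_and_not_dvd f hf a
  have hg0 : g ≠ 0 := by rintro rfl; simp at hga
  obtain ⟨h, hh, hhb⟩ := exists_eq_pow_rootMultiplicity_mul_and_not_dvd g hg0 b'
  have hmpos : 0 < f.rootMultiplicity a := (rootMultiplicity_pos hf).2 ha
  have hgb : g.eval b' = 0 := by
    have := hb'm.1
    rw [hg, eval_mul, eval_pow] at this
    rcases mul_eq_zero.1 this with h | h
    · have := (pow_eq_zero_iff hmpos.ne').1 h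
      simp only [eval_sub, eval_X, eval_C] at this
      linarith
    · exact h
  have hnpos : 0 < g.rootMultiplicity b' := (rootMultiplicity_pos hg0).2 hgb
  obtain ⟨m, hm⟩ := Nat.exists_eq_succ_of_ne_zero hmpos.ne'
  obtain ⟨n, hn⟩ := Nat.exists_eq_succ_of_ne_zero hnpos.ne'
  rw [hm] at hg
  rw [hn] at hh
  have hha : h.eval a ≠ 0 := fun h0 => hga (by
    rw [dvd_iff_isRoot, hh, IsRoot.def, eval_mul, h0, mul_zero])
  have hhb' : h.eval b' ≠ 0 := fun h0 => hhb (dvd_iff_isRoot.2 h0)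
  have hfh : f = (X - C a) ^ (m + 1) * ((X - C b') ^ (n + 1) * h) := by rw [hg, hh]
  have hne : ∀ z ∈ Set.Icc a b', h.eval z ≠ 0 := by
    intro z hz h0
    rcases hz.1.eq_or_lt with rfl | haz
    · exact hha h0
    rcases hz.2.eq_or_lt with rfl | hzb
    · exact hhb' h0
    have : b' ≤ z := hmin z (by
      simp only [Finset.mem_filter, Multiset.mem_toFinset, mem_roots hf, IsRoot.def, haz, and_true]
      rw [hfh]; simp [h0])
    exact absurd hzb (not_lt.2 this)
  have hsign := hR.sign_eq hab'.le hne
  set k : R[X] := C ((m : R) + 1) * (X - C b') * h + C ((n : R) + 1) * (X - C a) * h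
    + (X - C a) * (X - C b') * derivative h with hk
  have hder : derivative f = (X - C a) ^ m * (X - C b') ^ n * k := by
    rw [hfh, hk]
    simp only [derivative_mul, derivative_pow, derivative_sub, derivative_X, derivative_C]
    push_cast
    simp only [C_add, map_natCast, C_1]
    ring
  have hka : k.eval a = (m + 1) * (a - b') * h.eval a := by simp [hk]
  have hkb : k.eval b' = (n + 1) * (b' - a) * h.eval b' := by simp [hk]
  have hprod : 0 < h.eval a * h.eval b' := by
    rcases lt_or_gt_of_ne hha with h1 | h1
    · rw [sign_neg h1] at hsign
      exact mul_pos_of_neg_of_neg h1 (sign_eq_neg_one_iff.1 hsign.symm)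
    · rw [sign_pos h1] at hsign
      exact mul_pos h1 (sign_eq_one_iff.1 hsign.symm)
  obtain ⟨c, hc, hc0⟩ := hR k a b' hab' (by
    rw [hka, hkb]
    have h1 : (0 : R) < (m + 1) * (n + 1) := by positivity
    have h2 : 0 < (b' - a) * (b' - a) := mul_pos (sub_pos.2 hab') (sub_pos.2 hab')
    have h3 := mul_pos (mul_pos h1 h2) hprod
    calc _ = -((m + 1) * (n + 1) * ((b' - a) * (b' - a)) * (h.eval a * h.eval b')) := by ring
      _ < 0 := neg_lt_zero.2 h3)
  exact ⟨c, hc, by rw [hder, eval_mul, hc0, mul_zero]⟩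

theorem PolynomialIVT.exists_derivative_eq (hR : PolynomialIVT R) (f : R[X]) {a b : R}
    (hab : a < b) :
    ∃ c ∈ Set.Ioo a b, (derivative f).eval c * (b - a) = f.eval b - f.eval a := by
  obtain ⟨c, hc, h⟩ := hR.rolle (f := C (b - a) * (f - C (f.eval a))
    - C (f.eval b - f.eval a) * (X - C a)) hab (by simp) (by simp; ring)
  refine ⟨c, hc, ?_⟩
  simp at h
  linear_combination h

theorem PolynomialIVT.strictMonoOn_or_strictAntiOn (hR : PolynomialIVT R) {f : R[X]} {a b : R}
    (h : ∀ z ∈ Set.Ioo a b, (derivative f).eval z ≠ 0) :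
    StrictMonoOn (fun x => f.eval x) (Set.Icc a b) ∨
      StrictMonoOn (fun x => (-f).eval x) (Set.Icc a b) := by
  rcases le_or_gt b a with hab | hab
  · left
    intro x hx y hy hxy
    exact absurd hxy (not_lt.2 ((hy.2.trans hab).trans hx.1))
  obtain ⟨m, hm⟩ := exists_between hab
  have hs : ∀ z ∈ Set.Ioo a b, SignType.sign ((derivative f).eval z)
      = SignType.sign ((derivative f).eval m) := by
    intro z hz
    rcases le_total z m with hzm | hzm
    · exact hR.sign_eq hzm fun w hw => h w ⟨hz.1.trans_le hw.1, hw.2.trans_lt hm.2⟩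
    · exact (hR.sign_eq hzm fun w hw => h w ⟨hm.1.trans_le hw.1, hw.2.trans_lt hz.2⟩).symm
  rcases lt_or_gt_of_ne (h m hm) with hneg | hpos
  · right
    intro x hx y hy hxy
    obtain ⟨c, hc, hceq⟩ := hR.exists_derivative_eq f hxy
    have := hs c ⟨hx.1.trans_lt hc.1, hc.2.trans_le hy.2⟩
    rw [sign_neg hneg, sign_eq_neg_one_iff] at this
    have h2 := mul_neg_of_neg_of_pos this (sub_pos.2 hxy)
    simp only [eval_neg]
    linarith
  · left
    intro x hx y hy hxy
    obtain ⟨c, hc, hceq⟩ := hR.exists_derivative_eq f hxy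
    have := hs c ⟨hx.1.trans_lt hc.1, hc.2.trans_le hy.2⟩
    rw [sign_pos hpos, sign_eq_one_iff] at this
    have h2 := mul_pos this (sub_pos.2 hxy)
    show f.eval x < f.eval y
    linarith

theorem exists_forall_abs_eval_le (f : R[X]) (d : ℕ) (hf : f.natDegree ≤ d) :
    ∃ M : R, 0 ≤ M ∧ ∀ x, 1 ≤ |x| → |f.eval x| ≤ M * |x| ^ d := by
  refine ⟨∑ i ∈ Finset.range (f.natDegree + 1), |f.coeff i|,
    Finset.sum_nonneg fun _ _ => abs_nonneg _, fun x hx => ?_⟩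
  rw [eval_eq_sum_range, Finset.sum_mul]
  refine (Finset.abs_sum_le_sum_abs _ _).trans (Finset.sum_le_sum fun i hi => ?_)
  rw [abs_mul, abs_pow]
  exact mul_le_mul_of_nonneg_left (pow_le_pow_right₀ hx
    ((Nat.lt_succ_iff.1 (Finset.mem_range.1 hi)).trans hf)) (abs_nonneg _)

/-- Far from the origin a polynomial has the sign of its leading term. -/
theorem exists_forall_sign_eval_eq {f : R[X]} (hf : 0 < f.natDegree) :
    ∃ M : R, ∀ x, M ≤ |x| →
      SignType.sign (f.eval x) = SignType.sign (f.leadingCoeff * x ^ f.natDegree) := by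
  obtain ⟨M, hM0, hM⟩ := exists_forall_abs_eval_le f.eraseLead (f.natDegree - 1)
    (eraseLead_natDegree_le f)
  have hlc : f.leadingCoeff ≠ 0 := by
    intro h; rw [leadingCoeff_eq_zero] at h; simp [h] at hf
  refine ⟨max 1 (M / |f.leadingCoeff| + 1), fun x hx => ?_⟩
  have hx1 : 1 ≤ |x| := (le_max_left _ _).trans hx
  have hx0 : 0 < |x| := zero_lt_one.trans_le hx1
  have hx2 : M / |f.leadingCoeff| < |x| := (lt_add_one _).trans_le ((le_max_right _ _).trans hx)
  have hlt : |f.eraseLead.eval x| < |f.leadingCoeff * x ^ f.natDegree| := by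
    refine (hM x hx1).trans_lt ?_
    rw [div_lt_iff₀ (abs_pos.2 hlc)] at hx2
    obtain ⟨d, hd⟩ := Nat.exists_eq_succ_of_ne_zero hf.ne'
    rw [hd, abs_mul, abs_pow, Nat.succ_sub_one, pow_succ]
    calc M * |x| ^ d < (|x| * |f.leadingCoeff|) * |x| ^ d :=
          mul_lt_mul_of_pos_right hx2 (pow_pos hx0 d)
      _ = _ := by ring
  have heq : f.eval x = f.eraseLead.eval x + f.leadingCoeff * x ^ f.natDegree := by
    have := congrArg (eval x) f.eraseLead_add_C_mul_X_pow
    simpa only [eval_add, eval_mul, eval_C, eval_pow, eval_X] using this.symm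
  rw [heq]
  have := abs_lt.1 hlt
  rcases le_or_gt 0 (f.leadingCoeff * x ^ f.natDegree) with h | h
  · rw [abs_of_nonneg h] at this
    rw [sign_pos (by linarith), sign_pos (by linarith)]
  · rw [abs_of_neg h] at this
    rw [sign_neg (by linarith), sign_neg h]

end OrderedField

section SignLift

variable {R₁ R₂ : Type*} [Field R₁] [LinearOrder R₁] [IsStrictOrderedRing R₁]
  [Field R₂] [LinearOrder R₂] [IsStrictOrderedRing R₂]

theorem exists_strictMonoOn_of_succ {α β : Type*} [LinearOrder α] [LinearOrder β] [Nonempty β]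
    {E : α → β → Prop} (s : Finset α) (h₀ : ∀ x ∈ s, ∃ y, E x y)
    (h₁ : ∀ x ∈ s, ∀ x' ∈ s, ∀ y, x < x' → E x y → ∃ y', y < y' ∧ E x' y') :
    ∃ g : α → β, StrictMonoOn g s ∧ ∀ x ∈ s, E x (g x) := by
  classical
  induction s using Finset.induction_on_max with
  | empty => exact ⟨fun _ => Classical.arbitrary β, by simp [StrictMonoOn]⟩
  | insert m s hm ih =>
    obtain ⟨g, hg, hE⟩ := ih (fun x hx => h₀ x (Finset.mem_insert_of_mem hx))
      (fun x hx x' hx' => h₁ x (Finset.mem_insert_of_mem hx) x' (Finset.mem_insert_of_mem hx'))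
    have key : ∃ y, E m y ∧ ∀ x ∈ s, g x < y := by
      rcases s.eq_empty_or_nonempty with rfl | hs
      · obtain ⟨y, hy⟩ := h₀ m (Finset.mem_insert_self _ _)
        exact ⟨y, hy, by simp⟩
      · have hmem := s.max'_mem hs
        obtain ⟨y, hy, hEy⟩ := h₁ _ (Finset.mem_insert_of_mem hmem) m
          (Finset.mem_insert_self _ _) _ (hm _ hmem) (hE _ hmem)
        exact ⟨y, hEy, fun x hx =>
          (hg.monotoneOn hx hmem (s.le_max' x hx)).trans_lt hy⟩
    obtain ⟨y, hEy, hy⟩ := key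
    refine ⟨Function.update g m y, ?_, ?_⟩
    · intro a ha b hb hab
      rw [Finset.coe_insert, Set.mem_insert_iff, Finset.mem_coe] at ha hb
      rcases hb with rfl | hb
      · have ha' : a ∈ s := ha.resolve_left hab.ne
        rw [Function.update_self, Function.update_of_ne hab.ne]
        exact hy a ha'
      · have hbm := hm b hb
        have ham : a ≠ m := (hab.trans hbm).ne
        rw [Function.update_of_ne ham, Function.update_of_ne hbm.ne]
        exact hg (ha.resolve_left ham) hb hab
    · intro x hx
      rcases Finset.mem_insert.1 hx with rfl | hx
      · simpa using hEy
      · rw [Function.update_of_ne (hm x hx).ne]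
        exact hE x hx

omit [IsStrictOrderedRing R₁] in
theorem PolynomialIVT.exists_sign_eq_of_strictMonoOn (hR : PolynomialIVT R₂) {p : R₁[X]}
    {q : R₂[X]} {a b x x' : R₁} {y β : R₂} (hp : StrictMonoOn (fun z => p.eval z) (Set.Icc a b))
    (hb : SignType.sign (q.eval β) = SignType.sign (p.eval b)) (hax : a ≤ x) (hxx' : x < x')
    (hx'b : x' < b) (hy : SignType.sign (q.eval y) = SignType.sign (p.eval x)) (hyβ : y < β) :
    ∃ y' ∈ Set.Ioo y β, SignType.sign (q.eval y') = SignType.sign (p.eval x') := by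
  have h1 : p.eval x < p.eval x' :=
    hp ⟨hax, (hxx'.trans hx'b).le⟩ ⟨hax.trans hxx'.le, hx'b.le⟩ hxx'
  have h2 : p.eval x' < p.eval b :=
    hp ⟨hax.trans hxx'.le, hx'b.le⟩ ⟨(hax.trans hxx'.le).trans hx'b.le, le_rfl⟩ hx'b
  rcases lt_trichotomy (p.eval x') 0 with h | h | h
  · rw [sign_neg (h1.trans h)] at hy
    have hy' := sign_eq_neg_one_iff.1 hy
    obtain ⟨y', hy'', hs⟩ := hR.exists_sign_right hyβ hy'.ne
    exact ⟨y', hy'', by rw [hs, hy, sign_neg h]⟩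
  · rw [h] at h1 h2
    rw [sign_neg h1] at hy
    rw [sign_pos h2] at hb
    obtain ⟨c, hc, hc0⟩ := hR q y β hyβ
      (mul_neg_of_neg_of_pos (sign_eq_neg_one_iff.1 hy) (sign_eq_one_iff.1 hb))
    exact ⟨c, hc, by rw [hc0, h, sign_zero, sign_zero]⟩
  · rw [sign_pos (h.trans h2)] at hb
    have hb' := sign_eq_one_iff.1 hb
    obtain ⟨y', hy'', hs⟩ := hR.exists_sign_left hyβ hb'.ne'
    exact ⟨y', hy'', by rw [hs, hb, sign_pos h]⟩

theorem PolynomialIVT.exists_strictMonoOn_sign_eq (hR : PolynomialIVT R₂) {p : R₁[X]}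
    {q : R₂[X]} {s T : Finset R₁} (hTs : T ⊆ s) {g : R₁ → R₂} (hg : StrictMonoOn g s)
    (hp : ∀ a ∈ T, ∀ b ∈ T, (∀ t ∈ T, t ∉ Set.Ioo a b) →
      StrictMonoOn (fun z => p.eval z) (Set.Icc a b) ∨
      StrictMonoOn (fun z => (-p).eval z) (Set.Icc a b))
    (hT : ∀ t ∈ T, SignType.sign (q.eval (g t)) = SignType.sign (p.eval t))
    (hbdd : ∀ x ∈ s, (∃ a ∈ T, a ≤ x) ∧ ∃ b ∈ T, x ≤ b) :
    ∃ g' : R₁ → R₂, StrictMonoOn g' s ∧ ∀ x ∈ s,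
      SignType.sign (q.eval (g' x)) = SignType.sign (p.eval x) ∧ (x ∈ T → g' x = g x) ∧
      ∀ t ∈ T, (t < x → g t < g' x) ∧ (x < t → g' x < g t) := by
  classical
  set E : R₁ → R₂ → Prop := fun x y =>
      SignType.sign (q.eval y) = SignType.sign (p.eval x) ∧ (x ∈ T → y = g x) ∧
      ∀ t ∈ T, (t < x → g t < y) ∧ (x < t → y < g t) with hE
  have hET : ∀ t ∈ T, E t (g t) := fun t ht => ⟨hT t ht, fun _ => rfl, fun t' ht' =>
    ⟨fun h => hg (hTs ht') (hTs ht) h, fun h => hg (hTs ht) (hTs ht') h⟩⟩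
  have hsucc : ∀ x ∈ s, ∀ x' ∈ s, ∀ y, x < x' → E x y → ∃ y', y < y' ∧ E x' y' := by
    intro x hx x' hx' y hxx' hxy
    by_cases hx'T : x' ∈ T
    · exact ⟨g x', (hxy.2.2 x' hx'T).2 hxx', hET x' hx'T⟩
    obtain ⟨⟨a₀, ha₀, ha₀x⟩, b₀, hb₀, hb₀x⟩ := hbdd x' hx'
    obtain ⟨a, ha, hamax⟩ := (T.filter (· < x')).exists_max_image id ⟨a₀, by
      simp [ha₀, lt_of_le_of_ne ha₀x (fun h => hx'T (h ▸ ha₀))]⟩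
    obtain ⟨b, hb, hbmin⟩ := (T.filter (x' < ·)).exists_min_image id ⟨b₀, by
      simp [hb₀, lt_of_le_of_ne hb₀x (fun h => hx'T (h ▸ hb₀))]⟩
    simp only [Finset.mem_filter, id, and_imp] at ha hb hamax hbmin
    have hmono := hp a ha.1 b hb.1 (fun t ht htab => by
      rcases lt_trichotomy t x' with h | h | h
      · exact absurd htab.1 (not_lt.2 (hamax t ht h))
      · exact hx'T (h ▸ ht)
      · exact absurd htab.2 (not_lt.2 (hbmin t ht h)))
    obtain ⟨x₀, y₀, hy₀, hgy₀, hax₀, hx₀x', hs₀, hy₀b⟩ : ∃ x₀ y₀, y ≤ y₀ ∧ g a ≤ y₀ ∧ a ≤ x₀ ∧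
        x₀ < x' ∧ SignType.sign (q.eval y₀) = SignType.sign (p.eval x₀) ∧ y₀ < g b := by
      rcases lt_trichotomy a x with h | h | h
      · exact ⟨x, y, le_rfl, ((hxy.2.2 a ha.1).1 h).le, h.le, hxx', hxy.1,
          (hxy.2.2 b hb.1).2 (hxx'.trans hb.2)⟩
      · subst h
        exact ⟨a, y, le_rfl, (hxy.2.1 ha.1).ge, le_rfl, hxx', hxy.1,
          (hxy.2.2 b hb.1).2 (hxx'.trans hb.2)⟩
      · exact ⟨a, g a, ((hxy.2.2 a ha.1).2 h).le, le_rfl, le_rfl, ha.2, hT a ha.1,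
          hg (hTs ha.1) (hTs hb.1) (ha.2.trans hb.2)⟩
    obtain ⟨y', hy', hsy'⟩ : ∃ y' ∈ Set.Ioo y₀ (g b),
        SignType.sign (q.eval y') = SignType.sign (p.eval x') := by
      rcases hmono with hmono | hmono
      · exact hR.exists_sign_eq_of_strictMonoOn hmono (hT b hb.1) hax₀ hx₀x' hb.2 hs₀ hy₀b
      · obtain ⟨y', hy', hsy'⟩ := hR.exists_sign_eq_of_strictMonoOn (q := -q) (β := g b) hmono
          (by simp [Left.sign_neg, hT b hb.1]) hax₀ hx₀x' hb.2 (y := y₀)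
          (by simp [Left.sign_neg, hs₀]) hy₀b
        exact ⟨y', hy', by simpa [Left.sign_neg] using hsy'⟩
    refine ⟨y', hy₀.trans_lt hy'.1, hsy', fun h => absurd h hx'T, fun t ht => ⟨fun h => ?_,
      fun h => ?_⟩⟩
    · exact ((hg.monotoneOn (hTs ht) (hTs ha.1) (hamax t ht h)).trans hgy₀).trans_lt hy'.1
    · exact hy'.2.trans_le (hg.monotoneOn (hTs hb.1) (hTs ht) (hbmin t ht h))
  refine exists_strictMonoOn_of_succ (E := E) s (fun x hx => ?_) hsucc
  by_cases hxT : x ∈ T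
  · exact ⟨_, hET x hxT⟩
  · obtain ⟨⟨a, ha, hax⟩, -⟩ := hbdd x hx
    obtain ⟨y', -, hy'⟩ := hsucc a (hTs ha) x hx _
      (lt_of_le_of_ne hax fun h => hxT (h ▸ ha)) (hET a ha)
    exact ⟨y', hy'⟩

variable {A : Type*} [CommRing A]

/-- Every finite increasing chain in `R₁` can be matched by an increasing chain in `R₂` on which the
polynomials of `F` (transported by `φ₂`) have the same signs as on the original chain. -/
def SignLift (φ₁ : A →+* R₁) (φ₂ : A →+* R₂) (F : Finset A[X]) : Prop :=
  ∀ s : Finset R₁, ∃ g : R₁ → R₂, StrictMonoOn g s ∧ ∀ x ∈ s, ∀ f ∈ F,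
    SignType.sign (f.eval₂ φ₂ (g x)) = SignType.sign (f.eval₂ φ₁ x)

namespace SignLift

variable {φ₁ : A →+* R₁} {φ₂ : A →+* R₂} {F : Finset A[X]}

omit [IsStrictOrderedRing R₂] in
theorem map_ne_zero (h : SignLift φ₁ φ₂ F) {f : A[X]} (hf : f ∈ F) (hf₁ : f.map φ₁ ≠ 0) :
    f.map φ₂ ≠ 0 := by
  intro h0
  apply hf₁
  refine Polynomial.funext fun x => ?_
  obtain ⟨g, -, hg⟩ := h {x}
  have := hg x (by simp) f hf
  rw [← eval_map, ← eval_map, h0, eval_zero, sign_zero] at this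
  rw [eval_zero]
  exact sign_eq_zero_iff.1 this.symm

omit [IsStrictOrderedRing R₁] in
theorem of_base (h : ∀ f ∈ F, f.natDegree = 0 ∧
    SignType.sign (φ₂ (f.coeff 0)) = SignType.sign (φ₁ (f.coeff 0))) : SignLift φ₁ φ₂ F := by
  intro s
  obtain ⟨g, hg, -⟩ := exists_strictMonoOn_of_succ (E := fun (_ : R₁) (_ : R₂) => True) s
    (fun _ _ => ⟨0, trivial⟩) (fun _ _ _ _ y _ _ => ⟨y + 1, lt_add_one y, trivial⟩)
  refine ⟨g, hg, fun x _ f hf => ?_⟩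
  obtain ⟨h0, hs⟩ := h f hf
  rw [eq_C_of_natDegree_eq_zero h0, eval₂_C, eval₂_C, hs]

end SignLift

/-- The roots of the nonzero members of `F`. -/
noncomputable def rootSetOf (φ : A →+* R₁) (F : Finset A[X]) : Finset R₁ := by
  classical exact F.biUnion fun f => (f.map φ).roots.toFinset

omit [IsStrictOrderedRing R₁] in
theorem mem_rootSetOf {φ : A →+* R₁} {F : Finset A[X]} {x : R₁} :
    x ∈ rootSetOf φ F ↔ ∃ f ∈ F, f.map φ ≠ 0 ∧ f.eval₂ φ x = 0 := by
  classical
  simp [rootSetOf, eval_map]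

namespace SignLift

variable {φ₁ : A →+* R₁} {φ₂ : A →+* R₂} {F F' : Finset A[X]}

omit [IsStrictOrderedRing R₂] in
theorem map_mem_rootSetOf (h : SignLift φ₁ φ₂ F') (hF : F ⊆ F') {g : R₁ → R₂} {s : Finset R₁}
    (hg : ∀ x ∈ s, ∀ f ∈ F', SignType.sign (f.eval₂ φ₂ (g x)) = SignType.sign (f.eval₂ φ₁ x))
    {x : R₁} (hxs : x ∈ s) (hx : x ∈ rootSetOf φ₁ F) : g x ∈ rootSetOf φ₂ F := by
  obtain ⟨f, hf, hf0, hfx⟩ := mem_rootSetOf.1 hx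
  refine mem_rootSetOf.2 ⟨f, hf, h.map_ne_zero (hF hf) hf0, ?_⟩
  have := hg x hxs f (hF hf)
  rwa [hfx, sign_zero, sign_eq_zero_iff] at this

omit [IsStrictOrderedRing R₂] in
theorem card_le (h : SignLift φ₁ φ₂ F') (hF : F ⊆ F') :
    (rootSetOf φ₁ F).card ≤ (rootSetOf φ₂ F).card := by
  obtain ⟨g, hg, hs⟩ := h (rootSetOf φ₁ F)
  exact Finset.card_le_card_of_injOn g (fun x hx => h.map_mem_rootSetOf hF hs hx hx) hg.injOn

theorem exists_bound {R : Type*} [Field R] [LinearOrder R] [IsStrictOrderedRing R] (s : Finset R)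
    (M : R) : ∃ B : R, 0 < B ∧ M ≤ B ∧ ∀ x ∈ s, |x| < B := by
  classical
  obtain ⟨B, hB⟩ := (s.image abs ∪ {0, M}).exists_le
  refine ⟨B + 1, ?_, ?_, fun x hx => ?_⟩
  · have := hB 0 (by simp); linarith
  · have := hB M (by simp); linarith
  · have := hB |x| (Finset.mem_union_left _ (Finset.mem_image_of_mem _ hx)); linarith

theorem insert_of_remainders (hR₁ : PolynomialIVT R₁) (hR₂ : PolynomialIVT R₂)
    (h₁₂ : SignLift φ₁ φ₂ F') (h₂₁ : SignLift φ₂ φ₁ F') (hF : F ⊆ F') {p : A[X]}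
    (hder : derivative p ∈ F) (hdeg : 0 < p.natDegree) (hlc₁ : φ₁ p.leadingCoeff ≠ 0)
    (hlc : SignType.sign (φ₂ p.leadingCoeff) = SignType.sign (φ₁ p.leadingCoeff))
    (hrem : ∀ f ∈ F, f.map φ₁ ≠ 0 → ∃ r ∈ F',
      (∀ c, f.eval₂ φ₁ c = 0 → SignType.sign (p.eval₂ φ₁ c) = SignType.sign (r.eval₂ φ₁ c)) ∧
      (∀ c, f.eval₂ φ₂ c = 0 → SignType.sign (p.eval₂ φ₂ c) = SignType.sign (r.eval₂ φ₂ c)))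
    [DecidableEq A[X]] :
    SignLift φ₁ φ₂ (insert p F) := by
  classical
  have hlc₂ : φ₂ p.leadingCoeff ≠ 0 := by
    rw [← sign_ne_zero, hlc, sign_ne_zero]; exact hlc₁
  have hd₁ : (p.map φ₁).natDegree = p.natDegree := natDegree_map_of_leadingCoeff_ne_zero _ hlc₁
  have hd₂ : (p.map φ₂).natDegree = p.natDegree := natDegree_map_of_leadingCoeff_ne_zero _ hlc₂
  have hl₁ : (p.map φ₁).leadingCoeff = φ₁ p.leadingCoeff :=
    leadingCoeff_map_of_leadingCoeff_ne_zero _ hlc₁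
  have hl₂ : (p.map φ₂).leadingCoeff = φ₂ p.leadingCoeff :=
    leadingCoeff_map_of_leadingCoeff_ne_zero _ hlc₂
  have hder₁ : (derivative p).map φ₁ ≠ 0 := by
    rw [← derivative_map]
    intro h0
    rw [derivative_eq_zero] at h0
    omega
  obtain ⟨M₁, hM₁⟩ := exists_forall_sign_eval_eq (f := p.map φ₁) (hd₁ ▸ hdeg)
  obtain ⟨M₂, hM₂⟩ := exists_forall_sign_eval_eq (f := p.map φ₂) (hd₂ ▸ hdeg)
  rw [hd₁, hl₁] at hM₁
  rw [hd₂, hl₂] at hM₂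
  intro s
  obtain ⟨B₁, hB₁0, hB₁M, hB₁⟩ := exists_bound (s ∪ rootSetOf φ₁ F) M₁
  set s₀ : Finset R₁ := s ∪ rootSetOf φ₁ F with hs₀
  set s₁ : Finset R₁ := s₀ ∪ {-B₁, B₁} with hs₁
  obtain ⟨g, hg, hgs⟩ := h₁₂ s₁
  obtain ⟨B₂, hB₂0, hB₂M, hB₂⟩ := exists_bound (s₁.image g) M₂
  have hB₁s : B₁ ∈ s₁ := by simp [hs₁]
  have hB₁s' : -B₁ ∈ s₁ := by simp [hs₁]
  have hs₀s₁ : s₀ ⊆ s₁ := Finset.subset_union_left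
  have hZs₀ : rootSetOf φ₁ F ⊆ s₀ := Finset.subset_union_right
  have hgB : ∀ x ∈ s₁, -B₂ < g x ∧ g x < B₂ := fun x hx =>
    abs_lt.1 (hB₂ (g x) (Finset.mem_image_of_mem g hx))
  have hs₀B : ∀ x ∈ s₀, -B₁ < x ∧ x < B₁ := fun x hx => abs_lt.1 (hB₁ x hx)
  have hZ₂ : ∀ d ∈ rootSetOf φ₂ F, ∃ c ∈ rootSetOf φ₁ F, g c = d :=
    Finset.surjOn_of_injOn_of_card_le (s := rootSetOf φ₁ F) (t := rootSetOf φ₂ F) g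
      (fun c hc => h₁₂.map_mem_rootSetOf hF hgs (hs₀s₁ (hZs₀ hc)) hc)
      (hg.injOn.mono (Finset.coe_subset.2 (hZs₀.trans hs₀s₁))) (h₂₁.card_le hF)
  set g₁ : R₁ → R₂ := fun x => if x = B₁ then B₂ else if x = -B₁ then -B₂ else g x with hg₁
  have hg₁B : g₁ B₁ = B₂ := by simp [hg₁]
  have hg₁B' : g₁ (-B₁) = -B₂ := by
    have : -B₁ ≠ B₁ := by intro h; linarith
    simp [hg₁, this]
  have hg₁s : ∀ x ∈ s₀, g₁ x = g x := by
    intro x hx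
    obtain ⟨h1, h2⟩ := hs₀B x hx
    simp [hg₁, h2.ne, h1.ne']
  have hcases : ∀ x ∈ s₁, x = -B₁ ∨ x ∈ s₀ ∨ x = B₁ := by
    intro x hx
    simp only [hs₁, Finset.mem_union, Finset.mem_insert, Finset.mem_singleton] at hx
    tauto
  have hg₁mono : StrictMonoOn g₁ s₁ := by
    intro x hx y hy hxy
    rcases hcases x hx with rfl | hx' | rfl <;> rcases hcases y hy with rfl | hy' | rfl
    · exact absurd hxy (lt_irrefl _)
    · rw [hg₁B', hg₁s y hy']; exact (hgB y hy).1
    · rw [hg₁B', hg₁B]; linarith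
    · exact absurd hxy (hs₀B x hx').1.not_gt
    · rw [hg₁s x hx', hg₁s y hy']; exact hg hx hy hxy
    · rw [hg₁s x hx', hg₁B]; exact (hgB x hx).2
    · linarith
    · exact absurd hxy (hs₀B y hy').2.not_gt
    · exact absurd hxy (lt_irrefl _)
  set T : Finset R₁ := rootSetOf φ₁ F ∪ {-B₁, B₁} with hT
  have hTs : T ⊆ s₁ := Finset.union_subset_union hZs₀ le_rfl
  have hZT : rootSetOf φ₁ F ⊆ T := Finset.subset_union_left
  have hg₁sign : ∀ x ∈ s₁, ∀ f ∈ F,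
      SignType.sign (f.eval₂ φ₂ (g₁ x)) = SignType.sign (f.eval₂ φ₁ x) := by
    intro x hx f hf
    rw [← hgs x hx f (hF hf)]
    by_cases hf0 : f.map φ₂ = 0
    · rw [← eval_map, ← eval_map, hf0, eval_zero, eval_zero]
    have hroot : ∀ z, f.eval₂ φ₂ z = 0 → g (-B₁) < z ∧ z < g B₁ := by
      intro z hz
      obtain ⟨c, hc, rfl⟩ := hZ₂ z (mem_rootSetOf.2 ⟨f, hf, hf0, hz⟩)
      have hcs := hs₀s₁ (hZs₀ hc)
      obtain ⟨h1, h2⟩ := hs₀B c (hZs₀ hc)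
      exact ⟨hg hB₁s' hcs h1, hg hcs hB₁s h2⟩
    rcases hcases x hx with rfl | hx' | rfl
    · rw [hg₁B', ← eval_map, ← eval_map]
      refine hR₂.sign_eq (hgB _ hx).1.le fun z hz h0 => ?_
      rw [eval_map] at h0
      exact absurd (hroot z h0).1 (not_lt.2 hz.2)
    · rw [hg₁s x hx']
    · rw [hg₁B, ← eval_map, ← eval_map]
      refine (hR₂.sign_eq (hgB _ hx).2.le fun z hz h0 => ?_).symm
      rw [eval_map] at h0
      exact absurd (hroot z h0).2 (not_lt.2 hz.1)
  have hTsign : ∀ t ∈ T, SignType.sign ((p.map φ₂).eval (g₁ t)) =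
      SignType.sign ((p.map φ₁).eval t) := by
    intro t ht
    simp only [hT, Finset.mem_union, Finset.mem_insert, Finset.mem_singleton] at ht
    rcases ht with ht | rfl | rfl
    · obtain ⟨f, hf, hf0, hft⟩ := mem_rootSetOf.1 ht
      have hts := hs₀s₁ (hZs₀ ht)
      obtain ⟨r, hr, hr₁, hr₂⟩ := hrem f hf hf0
      have hft' := hg₁sign t hts f hf
      rw [hft, sign_zero, sign_eq_zero_iff] at hft'
      rw [eval_map, eval_map, hr₁ t hft, hr₂ _ hft', hg₁s t (hZs₀ ht), hgs t hts r hr]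
    · rw [hg₁B', hM₂ _ (by rw [abs_neg]; exact hB₂M.trans (le_abs_self _)),
        hM₁ _ (by rw [abs_neg]; exact hB₁M.trans (le_abs_self _)), sign_mul, sign_mul, hlc,
        sign_pow, sign_pow, sign_neg (neg_lt_zero.2 hB₁0), sign_neg (neg_lt_zero.2 hB₂0)]
    · rw [hg₁B, hM₂ _ (hB₂M.trans (le_abs_self _)), hM₁ _ (hB₁M.trans (le_abs_self _)),
        sign_mul, sign_mul, hlc, sign_pow, sign_pow, sign_pos hB₁0, sign_pos hB₂0]
  obtain ⟨g₂, hg₂, hg₂s⟩ := hR₂.exists_strictMonoOn_sign_eq (p := p.map φ₁) (q := p.map φ₂) hTs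
    hg₁mono (fun a ha b hb hab => hR₁.strictMonoOn_or_strictAntiOn fun z hz h0 => by
      rw [derivative_map, eval_map] at h0
      exact hab z (hZT (mem_rootSetOf.2 ⟨_, hder, hder₁, h0⟩)) hz) hTsign
    (fun x hx => ⟨⟨-B₁, by simp [hT], by
        rcases hcases x hx with rfl | hx' | rfl
        · exact le_rfl
        · exact (hs₀B x hx').1.le
        · linarith⟩, ⟨B₁, by simp [hT], by
        rcases hcases x hx with rfl | hx' | rfl
        · linarith
        · exact (hs₀B x hx').2.le
        · exact le_rfl⟩⟩)
  have hss₁ : s ⊆ s₁ := Finset.subset_union_left.trans hs₀s₁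
  refine ⟨g₂, hg₂.mono (Finset.coe_subset.2 hss₁), fun x hx f hf => ?_⟩
  obtain ⟨hpx, hTx, hord⟩ := hg₂s x (hss₁ hx)
  rcases Finset.mem_insert.1 hf with rfl | hf
  · rwa [eval_map, eval_map] at hpx
  rw [← hg₁sign x (hss₁ hx) f hf]
  by_cases hxT : x ∈ T
  · rw [hTx hxT]
  by_cases hf0 : f.map φ₂ = 0
  · rw [← eval_map, ← eval_map, hf0, eval_zero, eval_zero]
  have hroot : ∀ z, f.eval₂ φ₂ z = 0 → (z < g₁ x ∧ z < g₂ x) ∨ (g₁ x < z ∧ g₂ x < z) := by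
    intro z hz
    obtain ⟨c, hc, rfl⟩ := hZ₂ z (mem_rootSetOf.2 ⟨f, hf, hf0, hz⟩)
    have hcs := hs₀s₁ (hZs₀ hc)
    rw [← hg₁s c (hZs₀ hc)]
    rcases lt_trichotomy c x with h | h | h
    · exact Or.inl ⟨hg₁mono hcs (hss₁ hx) h, (hord c (hZT hc)).1 h⟩
    · exact absurd (hZT hc) (h ▸ hxT)
    · exact Or.inr ⟨hg₁mono (hss₁ hx) hcs h, (hord c (hZT hc)).2 h⟩
  rw [← eval_map, ← eval_map]
  rcases le_total (g₁ x) (g₂ x) with hle | hle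
  · refine (hR₂.sign_eq hle fun z hz h0 => ?_).symm
    rw [eval_map] at h0
    rcases hroot z h0 with h | h
    · exact absurd h.1 (not_lt.2 hz.1)
    · exact absurd h.2 (not_lt.2 hz.2)
  · refine hR₂.sign_eq hle fun z hz h0 => ?_
    rw [eval_map] at h0
    rcases hroot z h0 with h | h
    · exact absurd h.2 (not_lt.2 hz.1)
    · exact absurd h.1 (not_lt.2 hz.2)

end SignLift

end SignLift

section Elimination

theorem exists_pseudoDivision {A : Type*} [CommRing A] [IsDomain A] {f : A[X]} (hf : f ≠ 0)
    (p : A[X]) : ∃ (k : ℕ) (u r : A[X]),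
      C f.leadingCoeff ^ k * p = f * u + r ∧ r.degree < f.degree := by
  induction p using degree_lt_wf.induction with
  | _ p ih =>
    rcases lt_or_ge p.degree f.degree with h | h
    · exact ⟨0, 0, p, by simp, h⟩
    have hp : p ≠ 0 := by
      rintro rfl
      rw [degree_zero, le_bot_iff, degree_eq_bot] at h
      exact hf h
    have hf' : f.leadingCoeff ≠ 0 := leadingCoeff_ne_zero.2 hf
    have hp' : p.leadingCoeff ≠ 0 := leadingCoeff_ne_zero.2 hp
    have hdeg : f.natDegree ≤ p.natDegree := natDegree_le_natDegree h
    set w : A[X] := C p.leadingCoeff * X ^ (p.natDegree - f.natDegree) with hw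
    have hlt : (C f.leadingCoeff * p - w * f).degree < p.degree := by
      have h1 : (C f.leadingCoeff * p).degree = p.degree := degree_C_mul hf'
      have h2 : (w * f).degree = p.degree := by
        rw [hw, degree_mul, degree_C_mul_X_pow _ hp', degree_eq_natDegree hf,
          degree_eq_natDegree hp]
        exact_mod_cast Nat.sub_add_cancel hdeg
      rw [← h1]
      refine degree_sub_lt_left (h1.trans h2.symm) (mul_ne_zero (C_ne_zero.2 hf') hp) ?_
      rw [hw, leadingCoeff_mul, leadingCoeff_mul, leadingCoeff_mul, leadingCoeff_X_pow,
        leadingCoeff_C, leadingCoeff_C]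
      ring
    obtain ⟨k, u, r, hr, hrd⟩ := ih _ hlt
    refine ⟨k + 1, u + C f.leadingCoeff ^ k * w, r, ?_, hrd⟩
    linear_combination hr

variable {R₁ R₂ : Type*} [Field R₁] [LinearOrder R₁] [IsStrictOrderedRing R₁]
  [Field R₂] [LinearOrder R₂] [IsStrictOrderedRing R₂] {A : Type*} [CommRing A]

/-- The signs of the elements of `G` under `φ₁` and `φ₂` coincide. -/
def SignAgree (φ₁ : A →+* R₁) (φ₂ : A →+* R₂) (G : Finset A) : Prop :=
  ∀ a ∈ G, SignType.sign (φ₂ a) = SignType.sign (φ₁ a)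

omit [IsStrictOrderedRing R₁] [IsStrictOrderedRing R₂] in
theorem SignAgree.mono {φ₁ : A →+* R₁} {φ₂ : A →+* R₂} {G G' : Finset A}
    (h : SignAgree φ₁ φ₂ G') (hG : G ⊆ G') : SignAgree φ₁ φ₂ G := fun a ha => h a (hG ha)

omit [IsStrictOrderedRing R₁] [IsStrictOrderedRing R₂] in
theorem SignLift.mono {φ₁ : A →+* R₁} {φ₂ : A →+* R₂} {F F' : Finset A[X]}
    (h : SignLift φ₁ φ₂ F') (hF : F ⊆ F') : SignLift φ₁ φ₂ F := fun s => by
  obtain ⟨g, hg, hs⟩ := h s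
  exact ⟨g, hg, fun x hx f hf => hs x hx f (hF hf)⟩

theorem map_eraseLead_of_leadingCoeff {S : Type*} [CommRing S] {φ : A →+* S} {f : A[X]}
    (h : φ f.leadingCoeff = 0) : f.map φ = f.eraseLead.map φ := by
  have := congrArg (Polynomial.map φ) f.eraseLead_add_C_mul_X_pow
  rw [Polynomial.map_add, Polynomial.map_mul, map_C, h, C_0, zero_mul, add_zero] at this
  exact this.symm

theorem sign_eval₂_eq_of_pseudoDivision {R : Type*} [Field R] [LinearOrder R]
    [IsStrictOrderedRing R] {φ : A →+* R} {l : A} (hl : φ l ≠ 0) {k : ℕ} {p f u r : A[X]}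
    (h : C l ^ k * p = f * u + r) {c : R} (hc : f.eval₂ φ c = 0) :
    SignType.sign (p.eval₂ φ c) = SignType.sign ((C l ^ k * r).eval₂ φ c) := by
  have := congrArg (eval₂ φ c) h
  rw [eval₂_mul, eval₂_add, eval₂_mul, hc, zero_mul, zero_add, eval₂_pow, eval₂_C] at this
  rw [eval₂_mul, eval₂_pow, eval₂_C, ← this, ← mul_assoc, sign_mul, ← pow_add,
    (Even.add_self k).pow_pos hl |> sign_pos, one_mul]

variable [IsDomain A]

theorem exists_remainders (R₁ R₂ : Type*) [Field R₁] [LinearOrder R₁] [IsStrictOrderedRing R₁]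
    [Field R₂] [LinearOrder R₂] [IsStrictOrderedRing R₂] (p : A[X]) (d : ℕ) (f : A[X])
    (hf : f.natDegree ≤ d + 1) :
    ∃ (S : Finset A[X]) (G : Finset A), (∀ r ∈ S, r.natDegree ≤ d) ∧
      ∀ (φ₁ : A →+* R₁) (φ₂ : A →+* R₂), SignAgree φ₁ φ₂ G → f.map φ₁ ≠ 0 → ∃ r ∈ S,
      (∀ c, f.eval₂ φ₁ c = 0 → SignType.sign (p.eval₂ φ₁ c) = SignType.sign (r.eval₂ φ₁ c)) ∧
      (∀ c, f.eval₂ φ₂ c = 0 → SignType.sign (p.eval₂ φ₂ c) = SignType.sign (r.eval₂ φ₂ c)) := by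
  classical
  induction f using degree_lt_wf.induction with
  | _ f ih =>
    rcases eq_or_ne f 0 with rfl | hf0
    · exact ⟨∅, ∅, by simp, fun φ₁ φ₂ _ h => absurd (by simp) h⟩
    obtain ⟨k, u, r, hr, hrd⟩ := exists_pseudoDivision hf0 p
    obtain ⟨S, G, hS, hG⟩ := ih _ (degree_eraseLead_lt hf0)
      ((eraseLead_natDegree_le f).trans ((Nat.sub_le _ _).trans hf))
    refine ⟨insert (C f.leadingCoeff ^ k * r) S, insert f.leadingCoeff G, ?_,
      fun φ₁ φ₂ hφ hfφ => ?_⟩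
    · intro q hq
      rcases Finset.mem_insert.1 hq with rfl | hq
      · have h1 : (C f.leadingCoeff ^ k * r).natDegree ≤ r.natDegree := by
          rw [← C_pow]; exact natDegree_C_mul_le _ _
        rcases eq_or_ne r 0 with rfl | hr0
        · simp
        · have := natDegree_lt_natDegree hr0 hrd
          omega
      · exact hS q hq
    · have hl := hφ f.leadingCoeff (Finset.mem_insert_self _ _)
      by_cases h0 : φ₁ f.leadingCoeff = 0
      · rw [h0, sign_zero, sign_eq_zero_iff] at hl
        have e₁ := map_eraseLead_of_leadingCoeff h0
        have e₂ := map_eraseLead_of_leadingCoeff hl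
        obtain ⟨q, hq, hq₁, hq₂⟩ := hG φ₁ φ₂ (hφ.mono (Finset.subset_insert _ _)) (e₁ ▸ hfφ)
        simp only [← eval_map] at hq₁ hq₂ ⊢
        rw [e₁, e₂]
        exact ⟨q, Finset.mem_insert_of_mem hq, hq₁, hq₂⟩
      · have h0' : φ₂ f.leadingCoeff ≠ 0 := by
          rw [← sign_ne_zero, hl, sign_ne_zero]; exact h0
        exact ⟨_, Finset.mem_insert_self _ _,
          fun c hc => sign_eval₂_eq_of_pseudoDivision h0 hr hc,
          fun c hc => sign_eval₂_eq_of_pseudoDivision h0' hr hc⟩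

/-- Elimination of one variable: the sign behaviour of finitely many polynomials is controlled by
the signs of finitely many elements of the coefficient ring. -/
theorem exists_signAgree_signLift (hR₁ : PolynomialIVT R₁) (hR₂ : PolynomialIVT R₂)
    (F : Finset A[X]) : ∃ G : Finset A, ∀ (φ₁ : A →+* R₁) (φ₂ : A →+* R₂),
      SignAgree φ₁ φ₂ G → SignLift φ₁ φ₂ F ∧ SignLift φ₂ φ₁ F := by
  classical
  suffices ∀ (d : ℕ) (F : Finset A[X]), (∀ f ∈ F, f.natDegree ≤ d) →
      ∃ G : Finset A, ∀ (φ₁ : A →+* R₁) (φ₂ : A →+* R₂),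
      SignAgree φ₁ φ₂ G → SignLift φ₁ φ₂ F ∧ SignLift φ₂ φ₁ F from
    this (F.sup natDegree) F fun f hf => Finset.le_sup hf
  intro d
  induction d with
  | zero =>
    intro F hF
    refine ⟨F.image fun f => f.coeff 0, fun φ₁ φ₂ hφ => ⟨SignLift.of_base fun f hf => ?_,
      SignLift.of_base fun f hf => ?_⟩⟩
    · exact ⟨Nat.le_zero.1 (hF f hf), hφ _ (Finset.mem_image_of_mem _ hf)⟩
    · exact ⟨Nat.le_zero.1 (hF f hf), (hφ _ (Finset.mem_image_of_mem _ hf)).symm⟩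
  | succ d ihd =>
    suffices ∀ top low : Finset A[X], (∀ f ∈ top, f.natDegree ≤ d + 1) →
        (∀ f ∈ low, f.natDegree ≤ d) → ∃ G : Finset A, ∀ (φ₁ : A →+* R₁) (φ₂ : A →+* R₂),
        SignAgree φ₁ φ₂ G → SignLift φ₁ φ₂ (top ∪ low) ∧ SignLift φ₂ φ₁ (top ∪ low) from
      fun F hF => by simpa using this F ∅ hF (by simp)
    intro top
    induction top using Finset.induction_on with
    | empty => intro low _ hlow; simpa using ihd low hlow
    | insert p top _ ih =>
      intro low htop hlow
      have htop' : ∀ f ∈ top, f.natDegree ≤ d + 1 := fun f hf =>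
        htop f (Finset.mem_insert_of_mem hf)
      have hpd := htop p (Finset.mem_insert_self _ _)
      have hins : ∀ q : A[X], q.natDegree ≤ d → ∀ f ∈ insert q low, f.natDegree ≤ d := by
        intro q hq f hf
        rcases Finset.mem_insert.1 hf with rfl | hf
        exacts [hq, hlow f hf]
      rcases hpd.lt_or_eq with hpd | hpd
      · have := ih (insert p low) htop' (hins p (Nat.lt_succ_iff.1 hpd))
        rwa [Finset.union_insert, ← Finset.insert_union] at this
      have hderd : (derivative p).natDegree ≤ d := by
        have := natDegree_derivative_le p; omega
      have herd : p.eraseLead.natDegree ≤ d := by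
        have := eraseLead_natDegree_le p; omega
      set F₀ : Finset A[X] := top ∪ insert (derivative p) low with hF₀
      have hF₀d : ∀ f : F₀, f.1.natDegree ≤ d + 1 := by
        rintro ⟨f, hf⟩
        rcases Finset.mem_union.1 hf with hf | hf
        · exact htop' f hf
        · exact (hins _ hderd f hf).trans (Nat.le_succ d)
      choose S Gr hSd hGr using fun f : F₀ => exists_remainders R₁ R₂ p d f.1 (hF₀d f)
      obtain ⟨G₁, hG₁⟩ := ih (insert (derivative p) low ∪ Finset.univ.biUnion S) htop' (by
        intro f hf
        rcases Finset.mem_union.1 hf with hf | hf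
        · exact hins _ hderd f hf
        · obtain ⟨i, -, hi⟩ := Finset.mem_biUnion.1 hf
          exact hSd i f hi)
      obtain ⟨G₂, hG₂⟩ := ih (insert p.eraseLead low) htop' (hins _ herd)
      refine ⟨insert p.leadingCoeff (Finset.univ.biUnion Gr ∪ (G₁ ∪ G₂)), fun φ₁ φ₂ hφ => ?_⟩
      have hφr : ∀ i, SignAgree φ₁ φ₂ (Gr i) := fun i => hφ.mono fun a ha =>
        Finset.mem_insert_of_mem (Finset.mem_union_left _
          (Finset.mem_biUnion.2 ⟨i, Finset.mem_univ _, ha⟩))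
      have hφ₁ : SignAgree φ₁ φ₂ G₁ := hφ.mono fun a ha =>
        Finset.mem_insert_of_mem (Finset.mem_union_right _ (Finset.mem_union_left _ ha))
      have hφ₂ : SignAgree φ₁ φ₂ G₂ := hφ.mono fun a ha =>
        Finset.mem_insert_of_mem (Finset.mem_union_right _ (Finset.mem_union_right _ ha))
      have hl := hφ p.leadingCoeff (Finset.mem_insert_self _ _)
      by_cases h0 : φ₁ p.leadingCoeff = 0
      · rw [h0, sign_zero, sign_eq_zero_iff] at hl
        have e₁ := map_eraseLead_of_leadingCoeff h0
        have e₂ := map_eraseLead_of_leadingCoeff hl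
        obtain ⟨h₁₂, h₂₁⟩ := hG₂ φ₁ φ₂ hφ₂
        have hmem : ∀ f ∈ insert p top ∪ low, ∃ f' ∈ top ∪ insert p.eraseLead low,
            f.map φ₁ = f'.map φ₁ ∧ f.map φ₂ = f'.map φ₂ := by
          intro f hf
          rw [Finset.insert_union, Finset.mem_insert] at hf
          rcases hf with rfl | hf
          · exact ⟨_, by simp, e₁, e₂⟩
          · exact ⟨f, Finset.union_subset_union le_rfl (Finset.subset_insert _ _) hf, rfl, rfl⟩
        constructor
        · intro s
          obtain ⟨g, hg, hs⟩ := h₁₂ s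
          refine ⟨g, hg, fun x hx f hf => ?_⟩
          obtain ⟨f', hf', hf₁, hf₂⟩ := hmem f hf
          have := hs x hx f' hf'
          rwa [← eval_map, ← eval_map, ← hf₁, ← hf₂, eval_map, eval_map] at this
        · intro s
          obtain ⟨g, hg, hs⟩ := h₂₁ s
          refine ⟨g, hg, fun x hx f hf => ?_⟩
          obtain ⟨f', hf', hf₁, hf₂⟩ := hmem f hf
          have := hs x hx f' hf'
          rwa [← eval_map, ← eval_map, ← hf₁, ← hf₂, eval_map, eval_map] at this
      · have h0' : φ₂ p.leadingCoeff ≠ 0 := by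
          rw [← sign_ne_zero, hl, sign_ne_zero]; exact h0
        obtain ⟨h₁₂, h₂₁⟩ := hG₁ φ₁ φ₂ hφ₁
        have hsub : F₀ ⊆ top ∪ (insert (derivative p) low ∪ Finset.univ.biUnion S) :=
          Finset.union_subset_union le_rfl Finset.subset_union_left
        have hsub' : insert p top ∪ low ⊆ insert p F₀ := by
          rw [Finset.insert_union]
          exact Finset.insert_subset_insert _
            (Finset.union_subset_union le_rfl (Finset.subset_insert _ _))
        have hder : derivative p ∈ F₀ := by simp [hF₀]
        have hrem : ∀ f ∈ F₀, f.map φ₁ ≠ 0 →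
            ∃ r ∈ top ∪ (insert (derivative p) low ∪ Finset.univ.biUnion S),
            (∀ c, f.eval₂ φ₁ c = 0 →
              SignType.sign (p.eval₂ φ₁ c) = SignType.sign (r.eval₂ φ₁ c)) ∧
            (∀ c, f.eval₂ φ₂ c = 0 →
              SignType.sign (p.eval₂ φ₂ c) = SignType.sign (r.eval₂ φ₂ c)) := by
          intro f hf hf0
          obtain ⟨r, hr, hr'⟩ := hGr ⟨f, hf⟩ φ₁ φ₂ (hφr _) hf0
          exact ⟨r, Finset.mem_union_right _ (Finset.mem_union_right _
            (Finset.mem_biUnion.2 ⟨⟨f, hf⟩, Finset.mem_univ _, hr⟩)), hr'⟩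
        refine ⟨(h₁₂.insert_of_remainders hR₁ hR₂ h₂₁ hsub hder (by omega) h0 hl hrem).mono hsub',
          (h₂₁.insert_of_remainders hR₂ hR₁ h₁₂ hsub hder (by omega) h0' hl.symm
            fun f hf hf0 => ?_).mono hsub'⟩
        obtain ⟨r, hr, hr₁, hr₂⟩ := hrem f hf (h₂₁.map_ne_zero (hsub hf) hf0)
        exact ⟨r, hr, hr₂, hr₁⟩

omit [IsDomain A] in
theorem eval₂Hom_cons {S : Type*} [CommRing S] {n : ℕ} (φ : A →+* S) (y : S) (x : Fin n → S)
    (f : MvPolynomial (Fin (n + 1)) A) :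
    MvPolynomial.eval₂Hom φ (Fin.cons y x) f =
      (MvPolynomial.finSuccEquiv A n f).eval₂ (MvPolynomial.eval₂Hom φ x) y := by
  suffices MvPolynomial.eval₂Hom φ (Fin.cons y x : Fin (n + 1) → S) =
      (eval₂RingHom (MvPolynomial.eval₂Hom φ x) y).comp
        (MvPolynomial.finSuccEquiv A n).toRingEquiv.toRingHom from
    DFunLike.congr_fun this f
  refine MvPolynomial.ringHom_ext (fun a => ?_) (fun i => ?_)
  · simp [MvPolynomial.finSuccEquiv_apply]
  · refine Fin.cases ?_ (fun j => ?_) i <;> simp [MvPolynomial.finSuccEquiv_apply]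

/-- A form of the Tarski transfer principle. -/
theorem exists_signAgree_transfer (hR₁ : PolynomialIVT R₁) (hR₂ : PolynomialIVT R₂) (n : ℕ)
    (F : Finset (MvPolynomial (Fin n) A)) : ∃ G : Finset A, ∀ (φ₁ : A →+* R₁) (φ₂ : A →+* R₂),
      SignAgree φ₁ φ₂ G → ∀ x : Fin n → R₁, ∃ y : Fin n → R₂,
        SignAgree (MvPolynomial.eval₂Hom φ₁ x) (MvPolynomial.eval₂Hom φ₂ y) F := by
  classical
  induction n with
  | zero =>
    refine ⟨F.image (MvPolynomial.coeff 0), fun φ₁ φ₂ hφ x =>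
      ⟨Fin.elim0, fun f hf => ?_⟩⟩
    have := hφ _ (Finset.mem_image_of_mem _ hf)
    obtain ⟨a, rfl⟩ := MvPolynomial.C_surjective (Fin 0) f
    simpa [MvPolynomial.coeff_C] using this
  | succ n ih =>
    obtain ⟨G', hG'⟩ := exists_signAgree_signLift hR₁ hR₂ (F.image (MvPolynomial.finSuccEquiv A n))
    obtain ⟨G, hG⟩ := ih G'
    refine ⟨G, fun φ₁ φ₂ hφ x => ?_⟩
    obtain ⟨y, hy⟩ := hG φ₁ φ₂ hφ (Fin.tail x)
    obtain ⟨g, -, hg⟩ := (hG' _ _ hy).1 {x 0}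
    refine ⟨Fin.cons (g (x 0)) y, fun f hf => ?_⟩
    have := hg (x 0) (by simp) _ (Finset.mem_image_of_mem _ hf)
    rw [← eval₂Hom_cons, ← eval₂Hom_cons, Fin.cons_self_tail] at this
    exact this

end Elimination

section RealClosedExtension

/-- If a polynomial over `F` has a root in `L` then the elements `∑ pᵢ * sᵢ ^ 2`, `0 ≤ pᵢ`, of the
field generated by this root are represented by nonnegative polynomials of small degree. -/
theorem exists_nonneg_of_mem_closure {F L : Type*} [Field F] [LinearOrder F]
    [IsStrictOrderedRing F] [Field L] [Algebra F L] {f : F[X]} (hf : Irreducible f) {α : L}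
    (hα : aeval α f = 0) {t : L}
    (ht : t ∈ AddSubmonoid.closure {t : L | ∃ p : F, 0 ≤ p ∧ ∃ s ∈ IntermediateField.adjoin F {α},
      t = algebraMap F L p * s ^ 2}) :
    ∃ g : F[X], aeval α g = t ∧ g.natDegree ≤ 2 * f.natDegree - 2 ∧ ∀ c, 0 ≤ g.eval c := by
  have halg : IsAlgebraic F α := ⟨f, hf.ne_zero, hα⟩
  induction ht using AddSubmonoid.closure_induction with
  | zero => exact ⟨0, by simp, by simp, by simp⟩
  | add x y _ _ hx hy =>
    obtain ⟨g, rfl, hg, hg'⟩ := hx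
    obtain ⟨h, rfl, hh, hh'⟩ := hy
    refine ⟨g + h, by simp, (natDegree_add_le _ _).trans (max_le hg hh), fun c => ?_⟩
    rw [eval_add]
    exact add_nonneg (hg' c) (hh' c)
  | mem x hx =>
    obtain ⟨p, hp, s, hs, rfl⟩ := hx
    rw [← IntermediateField.mem_toSubalgebra,
      IntermediateField.adjoin_simple_toSubalgebra_of_isAlgebraic halg,
      Algebra.adjoin_singleton_eq_range_aeval] at hs
    obtain ⟨g, rfl⟩ := hs
    refine ⟨C p * (g % f) ^ 2, ?_, ?_, fun c => ?_⟩
    · have := congrArg (aeval α) (EuclideanDomain.div_add_mod g f)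
      rw [map_add, map_mul, hα, zero_mul, zero_add] at this
      simp [this]
    · have h1 := natDegree_mod_lt g hf.natDegree_pos.ne'
      have h2 := natDegree_C_mul_le p ((g % f) ^ 2)
      rw [natDegree_pow] at h2
      omega
    · simp only [eval_mul, eval_C, eval_pow]
      positivity

theorem polynomialIVT_of_maximal {F L : Type*} [Field F] [LinearOrder F] [IsStrictOrderedRing F]
    [Field L] [Algebra F L] [IsAlgClosed L]
    (hmax : ∀ E : IntermediateField F L, -1 ∉ AddSubmonoid.closure
      {t : L | ∃ p : F, 0 ≤ p ∧ ∃ s ∈ E, t = algebraMap F L p * s ^ 2} → E = ⊥) :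
    PolynomialIVT F := by
  intro f
  induction hd : f.natDegree using Nat.strong_induction_on generalizing f with
  | _ d ih =>
  subst hd
  intro a b hab h
  have hf0 : f ≠ 0 := by rintro rfl; simp at h
  have hfu : ¬ IsUnit f := by
    intro hu
    obtain ⟨c, -, rfl⟩ := isUnit_iff.1 hu
    simp only [eval_C] at h
    nlinarith [mul_self_nonneg c]
  by_cases hirr : Irreducible f
  swap
  · obtain ⟨g, k, hg, hk, rfl⟩ : ∃ g k, ¬ IsUnit g ∧ ¬ IsUnit k ∧ f = g * k := by
      by_contra! hcon
      exact hirr ⟨hfu, fun g k hgk => by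
        by_contra! hne
        exact hcon g k hne.1 hne.2 hgk⟩
    have hg0 := left_ne_zero_of_mul hf0
    have hk0 := right_ne_zero_of_mul hf0
    have hgd := natDegree_pos_iff_degree_pos.2 (degree_pos_of_ne_zero_of_nonunit hg0 hg)
    have hkd := natDegree_pos_iff_degree_pos.2 (degree_pos_of_ne_zero_of_nonunit hk0 hk)
    have hdeg := natDegree_mul hg0 hk0
    rw [eval_mul, eval_mul, mul_mul_mul_comm] at h
    rcases mul_neg_iff.1 h with ⟨-, h'⟩ | ⟨h', -⟩
    · obtain ⟨c, hc, hc'⟩ := ih _ (by omega) k rfl a b hab h'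
      exact ⟨c, hc, by rw [eval_mul, hc', mul_zero]⟩
    · obtain ⟨c, hc, hc'⟩ := ih _ (by omega) g rfl a b hab h'
      exact ⟨c, hc, by rw [eval_mul, hc', zero_mul]⟩
  obtain ⟨α, hα⟩ := IsAlgClosed.exists_aeval_eq_zero L f (degree_pos_of_irreducible hirr).ne'
  by_cases hneg : -1 ∈ AddSubmonoid.closure
      {t : L | ∃ p : F, 0 ≤ p ∧ ∃ s ∈ IntermediateField.adjoin F {α},
        t = algebraMap F L p * s ^ 2}
  · exfalso
    obtain ⟨g, hg, hgd, hg0⟩ := exists_nonneg_of_mem_closure hirr hα hneg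
    have hdvd : f ∣ 1 + g := by
      have : minpoly F α ∣ 1 + g := minpoly.dvd _ _ (by simp [hg])
      rw [← minpoly.eq_of_irreducible hirr hα] at this
      exact (dvd_mul_right _ _).trans this
    obtain ⟨k, hk⟩ := hdvd
    have hpos : ∀ c, 0 < f.eval c * k.eval c := fun c => by
      rw [← eval_mul, ← hk, eval_add, eval_one]
      linarith [hg0 c]
    have hk0 : k ≠ 0 := by
      rintro rfl
      simpa using hpos 0
    have hdeg := natDegree_mul hf0 hk0
    rw [← hk] at hdeg
    have h1 : (1 + g).natDegree ≤ 2 * f.natDegree - 2 :=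
      (natDegree_add_le _ _).trans (max_le (by simp) hgd)
    have hfd := hirr.natDegree_pos
    obtain ⟨c, -, hc⟩ := ih k.natDegree (by omega) k rfl a b hab (by
      have := mul_pos (hpos a) (hpos b)
      rw [mul_mul_mul_comm] at this
      exact (mul_pos_iff.1 this).elim (fun h' => absurd h'.1 h.not_gt) And.right)
    have := hpos c
    rw [hc, mul_zero] at this
    exact this.false
  · have hE := hmax _ hneg
    rw [IntermediateField.adjoin_simple_eq_bot_iff, IntermediateField.mem_bot] at hE
    obtain ⟨c, rfl⟩ := hE
    have hroot : f.IsRoot c := by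
      rw [aeval_algebraMap_apply, map_eq_zero_iff _ (algebraMap F L).injective] at hα
      simpa using hα
    obtain ⟨g, rfl⟩ := dvd_iff_isRoot.2 hroot
    have hg : IsUnit g := (hirr.isUnit_or_isUnit rfl).resolve_left (not_isUnit_X_sub_C c)
    obtain ⟨e, -, rfl⟩ := isUnit_iff.1 hg
    refine ⟨c, ?_, hroot⟩
    simp only [eval_mul, eval_sub, eval_X, eval_C] at h
    constructor
    · by_contra! hle
      nlinarith [mul_nonneg (mul_nonneg (sub_nonneg.2 hle) (sub_nonneg.2 (hle.trans hab.le)))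
        (mul_self_nonneg e)]
    · by_contra! hle
      nlinarith [mul_nonneg (mul_nonneg (sub_nonneg.2 hle) (sub_nonneg.2 (hab.le.trans hle)))
        (mul_self_nonneg e)]

variable {L : Type*} [Field L]

/-- The nonnegative elements of an ordering of a subfield of `L` form such a subsemiring, apart
from totality. -/
structure IsSubfieldCone (P : Subsemiring L) : Prop where
  neg_one_notMem : -1 ∉ P
  inv_mem : ∀ x ∈ P, x⁻¹ ∈ P
  sq_sub_mem : ∀ x ∈ P, ∀ y ∈ P, (x - y) ^ 2 ∈ P

namespace IsSubfieldCone

variable {P : Subsemiring L} (hP : IsSubfieldCone P)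
include hP

theorem two_ne_zero : (2 : L) ≠ 0 := fun h => hP.neg_one_notMem <| by
  rw [show (-1 : L) = 1 by linear_combination -h]
  exact one_mem P

theorem eq_zero {x : L} (hx : x ∈ P) (hx' : -x ∈ P) : x = 0 := by
  by_contra h0
  apply hP.neg_one_notMem
  rw [show (-1 : L) = -x * x⁻¹ by rw [neg_mul, mul_inv_cancel₀ h0]]
  exact mul_mem hx' (hP.inv_mem x hx)

/-- The subfield of differences of elements of a cone. -/
def subfield : Subfield L where
  carrier := {z | ∃ x ∈ P, ∃ y ∈ P, z = x - y}
  zero_mem' := ⟨0, zero_mem P, 0, zero_mem P, by ring⟩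
  one_mem' := ⟨1, one_mem P, 0, zero_mem P, by ring⟩
  add_mem' := by
    rintro _ _ ⟨x, hx, y, hy, rfl⟩ ⟨z, hz, w, hw, rfl⟩
    exact ⟨x + z, add_mem hx hz, y + w, add_mem hy hw, by ring⟩
  mul_mem' := by
    rintro _ _ ⟨x, hx, y, hy, rfl⟩ ⟨z, hz, w, hw, rfl⟩
    exact ⟨x * z + y * w, add_mem (mul_mem hx hz) (mul_mem hy hw), x * w + y * z,
      add_mem (mul_mem hx hw) (mul_mem hy hz), by ring⟩
  neg_mem' := by
    rintro _ ⟨x, hx, y, hy, rfl⟩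
    exact ⟨y, hy, x, hx, by ring⟩
  inv_mem' := by
    rintro _ ⟨x, hx, y, hy, rfl⟩
    have h := hP.inv_mem _ (hP.sq_sub_mem x hx y hy)
    refine ⟨x * ((x - y) ^ 2)⁻¹, mul_mem hx h, y * ((x - y) ^ 2)⁻¹, mul_mem hy h, ?_⟩
    rcases eq_or_ne (x - y) 0 with h0 | h0
    · simp [h0]
    · field_simp

theorem mem_subfield {z : L} : z ∈ hP.subfield ↔ ∃ x ∈ P, ∃ y ∈ P, z = x - y := Iff.rfl

theorem mem_subfield_of_mem {z : L} (hz : z ∈ P) : z ∈ hP.subfield :=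
  ⟨z, hz, 0, zero_mem P, by ring⟩

theorem sq_mem {z : L} (hz : z ∈ hP.subfield) : z ^ 2 ∈ P := by
  obtain ⟨x, hx, y, hy, rfl⟩ := hz
  exact hP.sq_sub_mem x hx y hy

theorem mem_subfield_of_sq {S : Subfield L} (h : ∀ s ∈ S, s ^ 2 ∈ P) {z : L} (hz : z ∈ S) :
    z ∈ hP.subfield := by
  have h2 := hP.two_ne_zero
  have hi : (2 : L)⁻¹ ∈ S := S.inv_mem (ofNat_mem S 2)
  refine ⟨((z + 1) * 2⁻¹) ^ 2, h _ (mul_mem (add_mem hz (one_mem S)) hi),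
    ((z - 1) * 2⁻¹) ^ 2, h _ (mul_mem (sub_mem hz (one_mem S)) hi), ?_⟩
  field_simp
  ring

theorem mem_or_neg_mem_of_maximal (hmax : ∀ P', IsSubfieldCone P' → P ≤ P' → P' ≤ P) {z : L}
    (hz : z ∈ hP.subfield) : z ∈ P ∨ -z ∈ P := by
  by_contra! hcon
  let P' : Subsemiring L :=
    { carrier := {t | ∃ p ∈ P, ∃ q ∈ P, t = p - q * z}
      zero_mem' := ⟨0, zero_mem P, 0, zero_mem P, by ring⟩
      one_mem' := ⟨1, one_mem P, 0, zero_mem P, by ring⟩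
      add_mem' := by
        rintro _ _ ⟨x, hx, y, hy, rfl⟩ ⟨u, hu, w, hw, rfl⟩
        exact ⟨x + u, add_mem hx hu, y + w, add_mem hy hw, by ring⟩
      mul_mem' := by
        rintro _ _ ⟨x, hx, y, hy, rfl⟩ ⟨u, hu, w, hw, rfl⟩
        exact ⟨x * u + y * w * z ^ 2,
          add_mem (mul_mem hx hu) (mul_mem (mul_mem hy hw) (hP.sq_mem hz)), x * w + y * u,
          add_mem (mul_mem hx hw) (mul_mem hy hu), by ring⟩ }
  have hle : P ≤ P' := fun p hp => ⟨p, hp, 0, zero_mem P, by ring⟩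
  have hsub : ∀ t ∈ P', t ∈ hP.subfield := by
    rintro _ ⟨p, hp, q, hq, rfl⟩
    exact sub_mem (hP.mem_subfield_of_mem hp) (mul_mem (hP.mem_subfield_of_mem hq) hz)
  have hP' : IsSubfieldCone P' := by
    refine ⟨?_, fun t ht => ?_, fun x hx y hy => ?_⟩
    · rintro ⟨p, hp, q, hq, h⟩
      have hq0 : q ≠ 0 := by
        rintro rfl
        exact hP.neg_one_notMem (by rwa [h, zero_mul, sub_zero])
      refine hcon.1 ?_
      rw [show z = (1 + p) * q⁻¹ by field_simp; linear_combination h]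
      exact mul_mem (add_mem (one_mem P) hp) (hP.inv_mem q hq)
    · rcases eq_or_ne t 0 with rfl | h0
      · rwa [inv_zero]
      rw [show t⁻¹ = t * (t ^ 2)⁻¹ by field_simp]
      exact mul_mem ht (hle (hP.inv_mem _ (hP.sq_mem (hsub t ht))))
    · exact hle (hP.sq_mem (sub_mem (hsub x hx) (hsub y hy)))
  exact hcon.2 (hmax P' hP' hle ⟨0, zero_mem P, 1, one_mem P, by ring⟩)

end IsSubfieldCone

/-- The subsemiring generated by the elements `p * s ^ 2` with `p ∈ P` and `s ∈ S`. -/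
def weightedSumSq (P : Subsemiring L) (S : Subfield L) : Subsemiring L :=
  Submonoid.subsemiringClosure
    { carrier := {t | ∃ p ∈ P, ∃ s ∈ S, t = p * s ^ 2}
      one_mem' := ⟨1, one_mem P, 1, one_mem S, by ring⟩
      mul_mem' := by
        rintro _ _ ⟨p, hp, s, hs, rfl⟩ ⟨q, hq, r, hr, rfl⟩
        exact ⟨p * q, mul_mem hp hq, s * r, mul_mem hs hr, by ring⟩ }

theorem mem_weightedSumSq {P : Subsemiring L} {S : Subfield L} {t : L} :
    t ∈ weightedSumSq P S ↔ t ∈ AddSubmonoid.closure {t | ∃ p ∈ P, ∃ s ∈ S, t = p * s ^ 2} :=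
  Iff.rfl

theorem sq_mem_weightedSumSq {P : Subsemiring L} {S : Subfield L} {s : L} (hs : s ∈ S) :
    s ^ 2 ∈ weightedSumSq P S :=
  mem_weightedSumSq.2 (AddSubmonoid.subset_closure ⟨1, one_mem P, s, hs, by ring⟩)

theorem le_weightedSumSq {P : Subsemiring L} {S : Subfield L} : P ≤ weightedSumSq P S :=
  fun p hp => mem_weightedSumSq.2 (AddSubmonoid.subset_closure ⟨p, hp, 1, one_mem S, by ring⟩)

theorem weightedSumSq_subset {P : Subsemiring L} {S : Subfield L} (h : ∀ p ∈ P, p ∈ S) {t : L}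
    (ht : t ∈ weightedSumSq P S) : t ∈ S := by
  refine AddSubmonoid.closure_le (S := S.toSubring.toAddSubgroup.toAddSubmonoid).2 ?_
    (mem_weightedSumSq.1 ht)
  rintro _ ⟨p, hp, s, hs, rfl⟩
  exact S.mul_mem (h p hp) (pow_mem hs 2)

theorem isSubfieldCone_weightedSumSq {P : Subsemiring L} {S : Subfield L} (h : ∀ p ∈ P, p ∈ S)
    (hneg : -1 ∉ weightedSumSq P S) : IsSubfieldCone (weightedSumSq P S) where
  neg_one_notMem := hneg
  inv_mem t ht := by
    rcases eq_or_ne t 0 with rfl | h0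
    · rwa [inv_zero]
    rw [show t⁻¹ = t * (t⁻¹) ^ 2 by field_simp]
    exact mul_mem ht (sq_mem_weightedSumSq (inv_mem (weightedSumSq_subset h ht)))
  sq_sub_mem x hx y hy :=
    sq_mem_weightedSumSq (sub_mem (weightedSumSq_subset h hx) (weightedSumSq_subset h hy))

theorem IsSubfieldCone.exists_maximal {P : Subsemiring L} (hP : IsSubfieldCone P) :
    ∃ M, P ≤ M ∧ IsSubfieldCone M ∧ ∀ P', IsSubfieldCone P' → M ≤ P' → P' ≤ M := by
  obtain ⟨M, hPM, hM⟩ := zorn_le_nonempty₀ {P : Subsemiring L | IsSubfieldCone P} (by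
    intro c hc hchain Q hQ
    have hne : c.Nonempty := ⟨Q, hQ⟩
    have hmem := fun {x : L} => Subsemiring.mem_sSup_of_directedOn hne hchain.directedOn (x := x)
    refine ⟨sSup c, ⟨?_, fun x hx => ?_, fun x hx y hy => ?_⟩, fun z hz => le_sSup hz⟩
    · intro h
      obtain ⟨s, hs, h⟩ := hmem.1 h
      exact (hc hs).neg_one_notMem h
    · obtain ⟨s, hs, h⟩ := hmem.1 hx
      exact hmem.2 ⟨s, hs, (hc hs).inv_mem x h⟩
    · obtain ⟨s, hs, hxs⟩ := hmem.1 hx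
      obtain ⟨t, ht, hyt⟩ := hmem.1 hy
      obtain ⟨u, hu, hsu, htu⟩ := hchain.directedOn s hs t ht
      exact hmem.2 ⟨u, hu, (hc hu).sq_sub_mem x (hsu hxs) y (htu hyt)⟩) P hP
  exact ⟨M, hPM, hM.prop, fun P' hP' h => hM.le_of_ge hP' h⟩

/-- The cone of nonnegative elements of the subfield of differences of a cone. -/
def IsSubfieldCone.ringCone {P : Subsemiring L} (hP : IsSubfieldCone P) :
    RingCone hP.subfield where
  __ := P.comap (hP.subfield.subtype : hP.subfield →+* L)
  eq_zero_of_mem_of_neg_mem' ha ha' := Subtype.ext (hP.eq_zero ha ha')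

theorem exists_polynomialIVT_extension.{u} {K : Type u} [Field K] (hK : ¬ IsSumSq (-1 : K)) :
    ∃ (R : Type u) (_ : Field R) (_ : LinearOrder R) (_ : IsStrictOrderedRing R),
      PolynomialIVT R ∧ Nonempty (K →+* R) := by
  classical
  let L := AlgebraicClosure K
  let S : Subfield L := (algebraMap K L).fieldRange
  have hbot : ∀ p ∈ (⊥ : Subsemiring L), p ∈ S := by
    intro p hp
    obtain ⟨k, rfl⟩ := Subsemiring.mem_bot.1 hp
    exact natCast_mem S k
  have hneg : -1 ∉ weightedSumSq (⊥ : Subsemiring L) S := by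
    intro h
    have hle : AddSubmonoid.closure {t : L | ∃ p ∈ (⊥ : Subsemiring L), ∃ s ∈ S, t = p * s ^ 2} ≤
        (AddSubmonoid.sumSq K).map (algebraMap K L) := by
      refine AddSubmonoid.closure_le.2 ?_
      rintro _ ⟨p, hp, _, ⟨s, rfl⟩, rfl⟩
      obtain ⟨k, rfl⟩ := Subsemiring.mem_bot.1 hp
      exact ⟨k • (s * s), nsmul_mem (AddSubmonoid.mem_sumSq.2 (IsSumSq.mul_self s)) k, by simp [sq]⟩
    obtain ⟨t, ht, hteq⟩ := hle (mem_weightedSumSq.1 h)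
    have : t = -1 := (algebraMap K L).injective (by simpa using hteq)
    exact hK (this ▸ AddSubmonoid.mem_sumSq.1 ht)
  obtain ⟨M, hPM, hM, hmax⟩ := (isSubfieldCone_weightedSumSq hbot hneg).exists_maximal
  have : HasMemOrNegMem hM.ringCone :=
    ⟨fun z => hM.mem_or_neg_mem_of_maximal hmax z.2⟩
  let : LinearOrder hM.subfield := LinearOrder.mkOfAddGroupCone hM.ringCone
  have : IsOrderedRing hM.subfield := IsOrderedRing.mkOfCone hM.ringCone
  have hnonneg : ∀ p : hM.subfield, 0 ≤ p ↔ (p : L) ∈ M := fun p => by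
    change p - 0 ∈ hM.ringCone ↔ _
    rw [sub_zero]
    rfl
  refine ⟨hM.subfield, inferInstance, inferInstance, IsOrderedRing.toIsStrictOrderedRing _, ?_,
    ⟨(algebraMap K L).codRestrict hM.subfield fun k => hM.mem_subfield_of_sq (S := S)
      (fun s hs => hPM (sq_mem_weightedSumSq hs)) ⟨k, rfl⟩⟩⟩
  have : IsStrictOrderedRing hM.subfield := IsOrderedRing.toIsStrictOrderedRing _
  refine polynomialIVT_of_maximal (L := L) fun E hE => ?_
  have hset : {t : L | ∃ p : hM.subfield, 0 ≤ p ∧ ∃ s ∈ E, t = algebraMap hM.subfield L p * s ^ 2} =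
      {t : L | ∃ p ∈ M, ∃ s ∈ E.toSubfield, t = p * s ^ 2} := by
    ext t
    constructor
    · rintro ⟨p, hp, s, hs, rfl⟩
      exact ⟨p, (hnonneg p).1 hp, s, hs, rfl⟩
    · rintro ⟨p, hp, s, hs, rfl⟩
      exact ⟨⟨p, hM.mem_subfield_of_mem hp⟩, (hnonneg _).2 hp, s, hs, rfl⟩
  rw [hset, ← mem_weightedSumSq] at hE
  have hMsub : ∀ p ∈ M, p ∈ E.toSubfield := fun p hp =>
    E.algebraMap_mem ⟨p, hM.mem_subfield_of_mem hp⟩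
  have hle := hmax _ (isSubfieldCone_weightedSumSq hMsub hE) le_weightedSumSq
  refine eq_bot_iff.2 fun s hs => IntermediateField.mem_bot.2 ⟨⟨s, ?_⟩, rfl⟩
  exact hM.mem_subfield_of_sq (S := E.toSubfield)
    (fun s hs => hle (sq_mem_weightedSumSq hs)) hs

end RealClosedExtension

section RealIdeal

/-- A real ideal: if a sum of squares belongs to it then so do the summands. -/
def IsRealIdeal {A : Type*} [CommRing A] (I : Ideal A) : Prop :=
  ∀ a t : A, IsSumSq t → a * a + t ∈ I → a ∈ I

theorem IsRealIdeal.exists_isPrime {A : Type*} [CommRing A] [IsNoetherianRing A] {J : Ideal A}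
    (hJ : IsRealIdeal J) {q : A} (hq : q ∉ J) :
    ∃ I : Ideal A, I.IsPrime ∧ IsRealIdeal I ∧ J ≤ I ∧ q ∉ I := by
  obtain ⟨I, ⟨hI, hJI, hqI⟩, hmax⟩ := set_has_maximal_iff_noetherian.2 ‹IsNoetherianRing A›
    {I : Ideal A | IsRealIdeal I ∧ J ≤ I ∧ q ∉ I} ⟨J, hJ, le_rfl, hq⟩
  have key : ∀ s b, s * b ∈ I → b ∉ I → s * q ∈ I := by
    intro s b hsb hb
    by_contra hsq
    let I' : Ideal A := Submodule.comap (LinearMap.mulLeft A s) I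
    have hle : I ≤ I' := fun x hx => Ideal.mul_mem_left _ s hx
    refine hmax I' ⟨fun a t ht hat => ?_, hJI.trans hle, hsq⟩
      (lt_of_le_of_ne hle fun h => hb (h ▸ hsb))
    refine hI (s * a) (s * s * t) ((IsSumSq.mul_self s).mul ht) ?_
    have h : s * (a * a + t) ∈ I := hat
    rw [show s * a * (s * a) + s * s * t = s * (s * (a * a + t)) by ring]
    exact Ideal.mul_mem_left _ s h
  refine ⟨I, ⟨fun h => hqI (h ▸ Submodule.mem_top), fun {a b} hab => ?_⟩, hI, hJI, hqI⟩
  by_contra! hcon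
  have h1 := key a b hab hcon.2
  have h2 := key q a (by rwa [mul_comm]) hcon.1
  exact hqI (hI q 0 .zero (by rwa [add_zero]))

theorem IsRealIdeal.not_isSumSq_neg_one {A : Type*} [CommRing A] {I : Ideal A} [I.IsPrime]
    (hI : IsRealIdeal I) : ¬ IsSumSq (-1 : FractionRing (A ⧸ I)) := by
  let φ : A →+* FractionRing (A ⧸ I) := (algebraMap (A ⧸ I) _).comp (Ideal.Quotient.mk I)
  have hφ : ∀ a, φ a = 0 ↔ a ∈ I := fun a => by
    simp only [φ, RingHom.comp_apply]
    rw [map_eq_zero_iff _ (IsFractionRing.injective (A ⧸ I) _), Ideal.Quotient.eq_zero_iff_mem]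
  have hsurj : ∀ z, ∃ a b, φ b ≠ 0 ∧ z * φ b = φ a := by
    intro z
    obtain ⟨x, y, hy, rfl⟩ := IsFractionRing.div_surjective (A := A ⧸ I) z
    obtain ⟨a, rfl⟩ := Ideal.Quotient.mk_surjective x
    obtain ⟨b, rfl⟩ := Ideal.Quotient.mk_surjective y
    have hb : φ b ≠ 0 :=
      IsFractionRing.to_map_ne_zero_of_mem_nonZeroDivisors (R := A ⧸ I) hy
    exact ⟨a, b, hb, div_mul_cancel₀ _ hb⟩
  have key : ∀ t : FractionRing (A ⧸ I), IsSumSq t →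
      ∃ b u, φ b ≠ 0 ∧ IsSumSq u ∧ t * (φ b * φ b) = φ u := by
    intro t ht
    induction ht with
    | zero => exact ⟨1, 0, by simp, .zero, by simp⟩
    | sq_add z s ih =>
      obtain ⟨b, u, hb, hu, h⟩ := ih
      obtain ⟨a, c, hc, h'⟩ := hsurj z
      refine ⟨b * c, (a * b) * (a * b) + (c * c) * u, by simp [hb, hc],
        (IsSumSq.mul_self _).add ((IsSumSq.mul_self _).mul hu), ?_⟩
      simp only [map_mul, map_add, ← h, ← h']
      ring
  intro h
  obtain ⟨b, u, hb, hu, h⟩ := key _ h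
  exact hb ((hφ b).2 (hI b u hu ((hφ _).1 (by rw [map_add, ← h, map_mul]; ring))))

theorem sign_ringHom_real {R : Type*} [Field R] [LinearOrder R] [IsStrictOrderedRing R]
    (φ : ℝ →+* R) (r : ℝ) : SignType.sign (φ r) = SignType.sign r := by
  have hpos : ∀ r : ℝ, 0 < r → 0 < φ r := fun r hr => by
    rw [← Real.mul_self_sqrt hr.le, map_mul]
    exact mul_self_pos.2 ((map_ne_zero φ).2 (Real.sqrt_pos.2 hr).ne')
  rcases lt_trichotomy r 0 with h | rfl | h
  · have := hpos (-r) (neg_pos.2 h)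
    rw [map_neg, neg_pos] at this
    rw [sign_neg h, sign_neg this]
  · simp
  · rw [sign_pos h, sign_pos (hpos r h)]

/-- A form of the real Nullstellensatz. -/
theorem IsRealIdeal.exists_eval_ne_zero {n : ℕ} {J : Ideal (MvPolynomial (Fin n) ℝ)}
    (hJ : IsRealIdeal J) {p q : MvPolynomial (Fin n) ℝ} (hp : p ∈ J) (hq : q ∉ J) :
    ∃ y : Fin n → ℝ, MvPolynomial.eval y p = 0 ∧ MvPolynomial.eval y q ≠ 0 := by
  classical
  obtain ⟨I, hprime, hI, hJI, hqI⟩ := hJ.exists_isPrime hq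
  obtain ⟨R, _, _, _, hR, ⟨ι⟩⟩ := exists_polynomialIVT_extension hI.not_isSumSq_neg_one
  let ψ : MvPolynomial (Fin n) ℝ ⧸ I →+* R := ι.comp (algebraMap _ _)
  have hψ : Function.Injective ψ :=
    ι.injective.comp (IsFractionRing.injective _ (FractionRing (MvPolynomial (Fin n) ℝ ⧸ I)))
  let σ : MvPolynomial (Fin n) ℝ →+* R := ψ.comp (Ideal.Quotient.mk I)
  have hσ : ∀ a, σ a = 0 ↔ a ∈ I := fun a => by
    rw [← Ideal.Quotient.eq_zero_iff_mem, ← map_eq_zero_iff ψ hψ]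
    rfl
  obtain ⟨G, hG⟩ := exists_signAgree_transfer hR polynomialIVT_real (A := ℝ) n {p, q}
  obtain ⟨y, hy⟩ := hG (σ.comp MvPolynomial.C) (RingHom.id ℝ)
    (fun a _ => (sign_ringHom_real _ a).symm) fun i => σ (MvPolynomial.X i)
  have hσe : MvPolynomial.eval₂Hom (σ.comp MvPolynomial.C) (fun i => σ (MvPolynomial.X i)) = σ :=
    MvPolynomial.ringHom_ext (by simp) (by simp)
  rw [hσe] at hy
  refine ⟨y, ?_, ?_⟩
  · have := hy p (by simp)
    rwa [(hσ p).2 (hJI hp), sign_zero, sign_eq_zero_iff] at this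
  · have := hy q (by simp)
    rw [← sign_ne_zero, show SignType.sign (MvPolynomial.eval y q) = _ from this, sign_ne_zero]
    exact mt (hσ q).1 hqI

end RealIdeal

section PositiveFunctional

variable {n : ℕ}

theorem eq_zero_of_forall_nonneg_add_mul {k z : ℂ} (h : ∀ r : ℝ, 0 ≤ k + r * z) : z = 0 := by
  have h0 := fun r => Complex.nonneg_iff.1 (h r)
  simp only [Complex.add_re, Complex.add_im, Complex.re_ofReal_mul, Complex.im_ofReal_mul] at h0
  apply Complex.ext
  · by_contra hne
    have := (h0 (-(k.re + 1) / z.re)).1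
    rw [div_mul_cancel₀ _ hne] at this
    linarith
  · have h1 := (h0 0).2
    have h2 := (h0 1).2
    rw [Complex.zero_im]
    linarith

theorem starC_add (F G : MvPolynomial (Fin n) ℂ) : starC (F + G) = starC F + starC G :=
  map_add _ _ _

theorem starC_mul (F G : MvPolynomial (Fin n) ℂ) : starC (F * G) = starC F * starC G :=
  map_mul _ _ _

theorem starC_starC (F : MvPolynomial (Fin n) ℂ) : starC (starC F) = F := by
  rw [starC, starC, MvPolynomial.map_map, show (starRingEnd ℂ).comp (starRingEnd ℂ) = RingHom.id ℂ
    from RingHom.ext Complex.conj_conj, MvPolynomial.map_id]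

theorem starC_C (c : ℂ) : starC (MvPolynomial.C c : MvPolynomial (Fin n) ℂ) =
    MvPolynomial.C (starRingEnd ℂ c) :=
  MvPolynomial.map_C _ _

theorem starC_map_ofReal (f : MvPolynomial (Fin n) ℝ) :
    starC (MvPolynomial.map Complex.ofRealHom f) = MvPolynomial.map Complex.ofRealHom f := by
  rw [starC, MvPolynomial.map_map, show (starRingEnd ℂ).comp Complex.ofRealHom = Complex.ofRealHom
    from RingHom.ext Complex.conj_ofReal]

/-- The Cauchy–Schwarz inequality for a positive functional, in the degenerate case. -/
theorem IsPosDefC.map_starC_mul_eq_zero {Λ : MvPolynomial (Fin n) ℂ →ₗ[ℂ] ℂ} (hΛ : IsPosDefC Λ)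
    {F : MvPolynomial (Fin n) ℂ} (hF : Λ (starC F * F) = 0) (G : MvPolynomial (Fin n) ℂ) :
    Λ (starC G * F) = 0 := by
  have key : ∀ c : ℂ, 0 ≤ Λ (starC G * G) +
      (c * Λ (starC G * F) + starRingEnd ℂ c * Λ (starC F * G)) := by
    intro c
    have h := hΛ (G + MvPolynomial.C c * F)
    have hexp : starC (G + MvPolynomial.C c * F) * (G + MvPolynomial.C c * F) =
        starC G * G + (c • (starC G * F) + starRingEnd ℂ c • (starC F * G)) +
          (starRingEnd ℂ c * c) • (starC F * F) := by
      rw [starC_add, starC_mul, starC_C]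
      simp only [MvPolynomial.smul_eq_C_mul, map_mul]
      ring
    rw [hexp] at h
    simpa [hF] using h
  have h1 : Λ (starC G * F) + Λ (starC F * G) = 0 :=
    eq_zero_of_forall_nonneg_add_mul (k := Λ (starC G * G)) fun r => by
      have := key r
      rwa [Complex.conj_ofReal, ← mul_add] at this
  have h2 : Complex.I * (Λ (starC G * F) - Λ (starC F * G)) = 0 :=
    eq_zero_of_forall_nonneg_add_mul (k := Λ (starC G * G)) fun r => by
      have := key (r * Complex.I)
      rw [map_mul (starRingEnd ℂ), Complex.conj_ofReal, Complex.conj_I] at this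
      convert this using 2
      ring
  have h3 := (mul_eq_zero.1 h2).resolve_left Complex.I_ne_zero
  linear_combination (h1 + h3) / 2

/-- The real polynomials in the left kernel of a positive functional. -/
def realKernel (Λ : MvPolynomial (Fin n) ℂ →ₗ[ℂ] ℂ) : Ideal (MvPolynomial (Fin n) ℝ) where
  carrier := {f | ∀ g, Λ (MvPolynomial.map Complex.ofRealHom f * g) = 0}
  zero_mem' g := by simp
  add_mem' {a b} ha hb g := by rw [map_add, add_mul, map_add, ha g, hb g, add_zero]
  smul_mem' c f hf g := by
    rw [smul_eq_mul, mul_comm c f, map_mul (MvPolynomial.map _), mul_assoc]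
    exact hf _

theorem mem_realKernel {Λ : MvPolynomial (Fin n) ℂ →ₗ[ℂ] ℂ} {f : MvPolynomial (Fin n) ℝ} :
    f ∈ realKernel Λ ↔ ∀ g, Λ (MvPolynomial.map Complex.ofRealHom f * g) = 0 := Iff.rfl

theorem IsPosDefC.isRealIdeal_realKernel {Λ : MvPolynomial (Fin n) ℂ →ₗ[ℂ] ℂ}
    (hΛ : IsPosDefC Λ) : IsRealIdeal (realKernel Λ) := by
  have hsq : ∀ a : MvPolynomial (Fin n) ℝ, 0 ≤ Λ (MvPolynomial.map Complex.ofRealHom (a * a)) :=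
    fun a => by
      have := hΛ (MvPolynomial.map Complex.ofRealHom a)
      rwa [starC_map_ofReal, ← map_mul] at this
  intro a t ht hat
  have ht' : 0 ≤ Λ (MvPolynomial.map Complex.ofRealHom t) := by
    clear hat
    induction ht with
    | zero => simp
    | sq_add b _ ih =>
      rw [map_add, map_add]
      exact add_nonneg (hsq b) ih
  have h := mem_realKernel.1 hat 1
  rw [mul_one, map_add, map_add] at h
  have h0 := ((add_eq_zero_iff_of_nonneg (hsq a) ht').1 h).1
  intro g
  have := hΛ.map_starC_mul_eq_zero (F := MvPolynomial.map Complex.ofRealHom a)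
    (by rwa [starC_map_ofReal, ← map_mul]) (starC g)
  rwa [starC_starC, mul_comm] at this

theorem exists_real_im (P : MvPolynomial (Fin n) ℂ) : ∃ a b : MvPolynomial (Fin n) ℝ,
    P = MvPolynomial.map Complex.ofRealHom a +
      MvPolynomial.C Complex.I * MvPolynomial.map Complex.ofRealHom b := by
  induction P using MvPolynomial.induction_on with
  | C z =>
    refine ⟨MvPolynomial.C z.re, MvPolynomial.C z.im, ?_⟩
    rw [MvPolynomial.map_C, MvPolynomial.map_C, ← map_mul, ← map_add]
    congr 1
    simp [mul_comm Complex.I, Complex.re_add_im]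
  | add P Q hP hQ =>
    obtain ⟨a, b, rfl⟩ := hP
    obtain ⟨c, d, rfl⟩ := hQ
    exact ⟨a + c, b + d, by rw [map_add, map_add]; ring⟩
  | mul_X P i hP =>
    obtain ⟨a, b, rfl⟩ := hP
    exact ⟨a * MvPolynomial.X i, b * MvPolynomial.X i, by
      rw [map_mul, map_mul, MvPolynomial.map_X]; ring⟩

theorem evalC_map_ofReal (f : MvPolynomial (Fin n) ℝ) (x : Fin n → ℝ) :
    evalC (MvPolynomial.map Complex.ofRealHom f) x = (MvPolynomial.eval x f : ℝ) := by
  suffices (MvPolynomial.aeval (R := ℂ) fun i => (x i : ℂ)).toRingHom.comp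
      (MvPolynomial.map Complex.ofRealHom) = Complex.ofRealHom.comp (MvPolynomial.eval x) from
    DFunLike.congr_fun this f
  refine MvPolynomial.ringHom_ext (fun a => ?_) (fun i => ?_) <;> simp

/-- The square of the absolute value of a polynomial on `ℝⁿ`. -/
theorem exists_real_starC_mul (P : MvPolynomial (Fin n) ℂ) : ∃ p : MvPolynomial (Fin n) ℝ,
    MvPolynomial.map Complex.ofRealHom p = starC P * P ∧
      ∀ x, MvPolynomial.eval x p = 0 ↔ evalC P x = 0 := by
  obtain ⟨a, b, rfl⟩ := exists_real_im P
  refine ⟨a * a + b * b, ?_, fun x => ?_⟩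
  · rw [starC_add, starC_mul, starC_C, starC_map_ofReal, starC_map_ofReal, Complex.conj_I,
      map_neg, map_add, map_mul, map_mul]
    have hI : (MvPolynomial.C Complex.I * MvPolynomial.C Complex.I : MvPolynomial (Fin n) ℂ) =
        -1 := by
      rw [← map_mul, Complex.I_mul_I, map_neg, map_one]
    linear_combination (MvPolynomial.map Complex.ofRealHom b) ^ 2 * hI
  · have he : evalC (MvPolynomial.map Complex.ofRealHom a +
        MvPolynomial.C Complex.I * MvPolynomial.map Complex.ofRealHom b) x =
        (MvPolynomial.eval x a : ℝ) + Complex.I * (MvPolynomial.eval x b : ℝ) := by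
      rw [← evalC_map_ofReal, ← evalC_map_ofReal]
      simp [evalC]
    rw [he, Complex.ext_iff]
    simp [mul_self_add_mul_self_eq_zero]

end PositiveFunctional

theorem stmt_7 (n : ℕ) (hn : 0 < n) (P Q : MvPolynomial (Fin n) ℂ)
    (hPQ : zSetC P ⊆ zSetC Q) (hQ : IsTypeAC Q) :
    IsTypeAC P := by
  intro Λ hΛ hP
  refine hQ Λ hΛ fun F hF => ?_
  obtain ⟨G, rfl⟩ := Ideal.mem_span_singleton.1 hF
  obtain ⟨p, hp, hp0⟩ := exists_real_starC_mul P
  obtain ⟨q, hq, hq0⟩ := exists_real_starC_mul Q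
  have hpJ : p ∈ realKernel Λ := fun g => by
    rw [hp]
    exact hP _ (Ideal.mem_span_singleton.2 ⟨starC P * g, by ring⟩)
  have hqJ : q ∈ realKernel Λ := by
    by_contra hcon
    obtain ⟨y, hy, hy'⟩ := hΛ.isRealIdeal_realKernel.exists_eval_ne_zero hpJ hcon
    exact hy' ((hq0 y).2 (hPQ ((hp0 y).1 hy)))
  have h := hΛ.map_starC_mul_eq_zero (F := Q * G) (by
    have := mem_realKernel.1 hqJ (starC G * G)
    rwa [hq, show starC Q * Q * (starC G * G) = starC (Q * G) * (Q * G) by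
      rw [starC_mul]; ring] at this) 1
  rwa [starC, map_one, one_mul] at h
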